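/- arXiv:1105.5422 — 2 statements merged into one kernel-verified Lean document; each statement's English description precedes it below -/
import Mathlib

section
/- Quantitative form of the Infinite Girth Criterion: Let G be a group acting on a set X, generated by a finite set {γ₁, …, γₙ}, and suppose σ, τ ∈ G, subsets U_σ, U_τ ⊆ X, and a point x ∈ X satisfy: (1) x ∉ (U_σ ∪ U_τ) ∪ ⋃_{ε=±1} ⋃_{i=1}^{n} γᵢ^ε(U_σ ∪ U_τ); (2) σ^k({x} ∪ U_τ ∪ ⋃_{ε=±1} ⋃_{i=1}^{n} γᵢ^ε(U_τ)) ⊆ U_σ for all nonzero integers k; and (3) τ^k({x} ∪ U_σ ∪ ⋃_{ε=±1} ⋃_{i=1}^{n} γᵢ^ε(U_σ)) ⊆ U_τ for all nonzero integers k. Let M be a positive integer and let p₁, …, pₙ be positive integers with pᵢ > M for all i and |pᵢ − pⱼ| > M for all i ≠ j. Then the set Ĝ = {σ, τ, σ^{p₁}γ₁τ^{−p₁}, …, σ^{pₙ}γₙτ^{−pₙ}} generates G, and every nonempty reduced word of length less than M in the letters Ĝ ∪ Ĝ⁻¹ represents a non-identity element of G; in particular U(G, Ĝ) ≥ M. 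-/
open Pointwise

/-- A nonempty reduced word in the letters `S ∪ S⁻¹` (no letter immediately followed by
its inverse) that represents the identity element of the group. -/
def IsRelatorWord {G : Type*} [Group G] (S : Set G) (w : List G) : Prop :=
  w ≠ [] ∧ (∀ g ∈ w, g ∈ S ∨ g⁻¹ ∈ S) ∧ List.Chain' (fun a b => b ≠ a⁻¹) w ∧ w.prod = 1

/-- The girth `U(G,S)` of the Cayley graph of `G` with respect to `S`: the infimum in `ℕ∞`
of the lengths of nonempty reduced words in the letters `S ∪ S⁻¹` representing `1`. -/
noncomputable def girthWith {G : Type*} [Group G] (S : Set G) : ℕ∞ :=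
  ⨅ w ∈ {w : List G | IsRelatorWord S w}, (w.length : ℕ∞)

/-- The girth `U(G)` of a group `G`: the supremum of `U(G,S)` over all finite
generating sets `S` of `G`. -/
noncomputable def groupGirth (G : Type*) [Group G] : ℕ∞ :=
  ⨆ S ∈ {S : Finset G | Subgroup.closure (S : Set G) = ⊤}, girthWith (S : Set G)

/-- Letter `D i b` of the word: `δᵢ` or its inverse. -/
def girthD {G : Type*} [Group G] {n : ℕ} (ρ : Bool → G) (g : Fin n → Bool → G) (p : Fin n → ℕ)
    (i : Fin n) (b : Bool) : G :=
  ρ b ^ (p i : ℤ) * g i b * ρ (!b) ^ (-(p i : ℤ))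

lemma girth_inv {G X : Type*} [Group G] [MulAction G X]
    (n : ℕ) (ρ : Bool → G) (g : Fin n → Bool → G) (hg : ∀ i b, g i (!b) = (g i b)⁻¹)
    (U Y : Bool → Set X) (x : X)
    (hx : ∀ b, x ∈ Y b) (hUY : ∀ b, U (!b) ⊆ Y b)
    (hgY : ∀ i b z, z ∈ U (!b) → g i b • z ∈ Y b)
    (hY : ∀ b (k : ℤ), k ≠ 0 → ∀ y ∈ Y b, ρ b ^ k • y ∈ U b)
    (M : ℕ) (p : Fin n → ℕ) (hp : ∀ i, M < p i)
    (hpp : ∀ i j, i ≠ j → (M : ℤ) < |(p i : ℤ) - (p j : ℤ)|) :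
    ∀ w : List G, (∀ l ∈ w, ∃ b, l = ρ b ∨ l = (ρ b)⁻¹ ∨ ∃ i, l = girthD ρ g p i b) →
      List.IsChain (fun a b => b ≠ a⁻¹) w → w.length < M → w = [] ∨
      ∃ (h : G) (t : List G), w = h :: t ∧ ∃ (b : Bool) (a c : ℤ) (y : X), y ∈ Y b ∧
        w.prod • x = ρ b ^ (a + c) • y ∧ |a| ≤ w.length ∧
        ((c = 0 ∧ a ≠ 0) ∨ ∃ i, c = p i ∧ (a = 0 → h = girthD ρ g p i b)) ∧
        (0 < a → h = ρ b) ∧ (a < 0 → h = (ρ b)⁻¹) := by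
  intro w
  induction w with
  | nil => intros; left; rfl
  | cons l t ih =>
    intro hl hch hlen
    right
    refine ⟨l, t, rfl, ?_⟩
    have ih' := ih (fun l' h' => hl l' (List.mem_cons_of_mem _ h')) hch.tail
      (by simp at hlen; omega)
    have hl' := hl l (by simp)
    simp only [List.length_cons] at hlen
    have hM : ∀ i, (M : ℤ) < p i := fun i => by exact_mod_cast hp i
    have hlenZ : (t.length : ℤ) + 1 < M := by exact_mod_cast hlen
    -- new power letter from a point in `Y b`
    have newpow : ∀ b, t.prod • x ∈ Y b → (l = ρ b ∨ l = (ρ b)⁻¹) →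
        ∃ (b : Bool) (a c : ℤ) (y : X), y ∈ Y b ∧
        (l :: t).prod • x = ρ b ^ (a + c) • y ∧ |a| ≤ (l :: t).length ∧
        ((c = 0 ∧ a ≠ 0) ∨ ∃ i, c = p i ∧ (a = 0 → l = girthD ρ g p i b)) ∧
        (0 < a → l = ρ b) ∧ (a < 0 → l = (ρ b)⁻¹) := by
      intro b hb hh
      rcases hh with hh | hh
      · exact ⟨b, 1, 0, _, hb, by simp [hh, mul_smul], by simp,
          Or.inl (by simp), fun _ => hh, fun h => by omega⟩
      · exact ⟨b, -1, 0, _, hb, by simp [hh, mul_smul], by simp,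
          Or.inl (by simp), fun h => by omega, fun _ => hh⟩
    have newD : ∀ i b, ρ (!b) ^ (-(p i : ℤ)) • (t.prod • x) ∈ U (!b) → l = girthD ρ g p i b →
        ∃ (b : Bool) (a c : ℤ) (y : X), y ∈ Y b ∧
        (l :: t).prod • x = ρ b ^ (a + c) • y ∧ |a| ≤ (l :: t).length ∧
        ((c = 0 ∧ a ≠ 0) ∨ ∃ i, c = p i ∧ (a = 0 → l = girthD ρ g p i b)) ∧
        (0 < a → l = ρ b) ∧ (a < 0 → l = (ρ b)⁻¹) := by
      intro i b hb hh
      refine ⟨b, 0, p i, _, hgY i b _ hb, ?_, by simp; positivity,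
          Or.inr ⟨i, rfl, fun _ => hh⟩, fun h => by omega, fun h => by omega⟩
      rw [List.prod_cons, hh, girthD, zero_add]
      simp only [mul_smul]
    rcases ih' with rfl | ⟨h, t', rfl, b, a, c, y, hy, hprod, ha, hc, hpos, hneg⟩
    · obtain ⟨b, hb | hb | ⟨i, hb⟩⟩ := hl'
      · exact newpow b (by simpa using hx b) (Or.inl hb)
      · exact newpow b (by simpa using hx b) (Or.inr hb)
      · refine newD i b (hY _ _ ?_ _ (by simpa using hx _)) hb
        have := hM i
        omega
    · have hne : h ≠ l⁻¹ := by
        have := hch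
        simp only [List.isChain_cons_cons] at this
        exact this.1
      have hac : a + c ≠ 0 := by
        rcases hc with ⟨rfl, h0⟩ | ⟨i, rfl, -⟩
        · simpa using h0
        · have := hM i
          have := abs_le.1 ha
          omega
      have hU : (h :: t').prod • x ∈ U b := hprod ▸ hY b _ hac y hy
      have hU' : (h :: t').prod • x ∈ Y (!b) := hUY (!b) (by simpa using hU)
      obtain ⟨b', hb⟩ := hl'
      by_cases hbb : b' = b
      · subst hbb
        rcases hb with hb | hb | ⟨i, hb⟩
        · have ha0 : 0 ≤ a := by
            by_contra hcon
            exact hne (by rw [hneg (by omega), hb])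
          refine ⟨b', a + 1, c, y, hy, ?_, ?_, ?_, fun _ => hb, fun h => by omega⟩
          · rw [List.prod_cons, mul_smul, hprod, hb, ← mul_smul, ← zpow_one_add]
            congr 2; ring
          · rw [List.length_cons]; push_cast
            rw [abs_le] at *; constructor <;> omega
          · rcases hc with ⟨h0, -⟩ | ⟨i, h0, -⟩
            · exact Or.inl ⟨h0, by omega⟩
            · exact Or.inr ⟨i, h0, fun h => by omega⟩
        · have ha0 : a ≤ 0 := by
            by_contra hcon
            exact hne (by rw [hpos (by omega), hb, inv_inv])
          refine ⟨b', a - 1, c, y, hy, ?_, ?_, ?_, fun h => by omega, fun _ => hb⟩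
          · rw [List.prod_cons, mul_smul, hprod, hb, ← mul_smul, ← zpow_neg_one, ← zpow_add]
            congr 2; ring
          · rw [List.length_cons]; push_cast
            rw [abs_le] at *; constructor <;> omega
          · rcases hc with ⟨h0, -⟩ | ⟨i, h0, -⟩
            · exact Or.inl ⟨h0, by omega⟩
            · exact Or.inr ⟨i, h0, fun h => by omega⟩
        · refine newD i b' (hY _ _ ?_ _ hU') hb
          have := hM i
          omega
      · have hbb' : b' = !b := by
          revert hbb; cases b <;> cases b' <;> simp
        subst hbb'
        rcases hb with hb | hb | ⟨i, hb⟩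
        · exact newpow _ hU' (Or.inl hb)
        · exact newpow _ hU' (Or.inr hb)
        · refine newD i _ ?_ hb
          rw [hprod, ← mul_smul, Bool.not_not, ← zpow_add]
          refine hY b _ ?_ y hy
          have h3 := abs_le.1 ha
          rcases hc with ⟨rfl, -⟩ | ⟨j, rfl, hj⟩
          · have := hM i
            omega
          · by_cases hij : i = j
            · subst hij
              intro h0
              have : a = 0 := by omega
              apply hne
              rw [hj this, hb]
              simp [girthD, hg, mul_assoc]
            · have h4 := hpp i j hij
              intro h0
              have : (p i : ℤ) - p j = a := by omega
              rw [this] at h4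
              omega

/-- **Quantitative form of the Infinite Girth Criterion.** -/
theorem infinite_girth_criterion_quantitative {G X : Type*} [Group G] [MulAction G X]
    (n : ℕ) (γ : Fin n → G) (hgen : Subgroup.closure (Set.range γ) = ⊤)
    (σ τ : G) (Uσ Uτ : Set X) (x : X)
    (h1 : x ∉ (Uσ ∪ Uτ) ∪ ⋃ i, (γ i • (Uσ ∪ Uτ) ∪ (γ i)⁻¹ • (Uσ ∪ Uτ)))
    (h2 : ∀ k : ℤ, k ≠ 0 →
      (σ ^ k) • ({x} ∪ Uτ ∪ ⋃ i, (γ i • Uτ ∪ (γ i)⁻¹ • Uτ)) ⊆ Uσ)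
    (h3 : ∀ k : ℤ, k ≠ 0 →
      (τ ^ k) • ({x} ∪ Uσ ∪ ⋃ i, (γ i • Uσ ∪ (γ i)⁻¹ • Uσ)) ⊆ Uτ)
    (M : ℕ) (hM : 0 < M) (p : Fin n → ℕ)
    (hp : ∀ i, M < p i)
    (hpp : ∀ i j, i ≠ j → (M : ℤ) < |(p i : ℤ) - (p j : ℤ)|) :
    Subgroup.closure
        ({σ, τ} ∪ Set.range (fun i => σ ^ p i * γ i * (τ ^ p i)⁻¹) : Set G) = ⊤ ∧
    (∀ w : List G, w ≠ [] →
      (∀ g ∈ w, g ∈ ({σ, τ} ∪ Set.range (fun i => σ ^ p i * γ i * (τ ^ p i)⁻¹) : Set G) ∨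
        g⁻¹ ∈ ({σ, τ} ∪ Set.range (fun i => σ ^ p i * γ i * (τ ^ p i)⁻¹) : Set G)) →
      List.Chain' (fun a b => b ≠ a⁻¹) w → w.length < M → w.prod ≠ 1) ∧
    (M : ℕ∞) ≤ girthWith ({σ, τ} ∪ Set.range (fun i => σ ^ p i * γ i * (τ ^ p i)⁻¹) : Set G) := by
  set S : Set G := ({σ, τ} ∪ Set.range (fun i => σ ^ p i * γ i * (τ ^ p i)⁻¹) : Set G) with hS
  have main : ∀ w : List G, w ≠ [] → (∀ g ∈ w, g ∈ S ∨ g⁻¹ ∈ S) →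
      List.IsChain (fun a b => b ≠ a⁻¹) w → w.length < M → w.prod ≠ 1 := by
    intro w hw hl hch hlen hprod
    let ρ : Bool → G := fun b => bif b then σ else τ
    let g : Fin n → Bool → G := fun i b => bif b then γ i else (γ i)⁻¹
    let U : Bool → Set X := fun b => bif b then Uσ else Uτ
    let Y : Bool → Set X := fun b => {x} ∪ U (!b) ∪ ⋃ i, (γ i • U (!b) ∪ (γ i)⁻¹ • U (!b))
    have hY : ∀ b (k : ℤ), k ≠ 0 → ∀ y ∈ Y b, ρ b ^ k • y ∈ U b := by
      intro b k hk y hy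
      cases b
      · exact h3 k hk (Set.smul_mem_smul_set hy)
      · exact h2 k hk (Set.smul_mem_smul_set hy)
    have key := girth_inv n ρ g (by intro i b; cases b <;> simp [g]) U Y x
      (by intro b; exact Or.inl (Or.inl rfl))
      (by intro b z hz; exact Or.inl (Or.inr hz))
      (by
        intro i b z hz
        refine Or.inr (Set.mem_iUnion.2 ⟨i, ?_⟩)
        cases b
        · exact Or.inr (Set.smul_mem_smul_set hz)
        · exact Or.inl (Set.smul_mem_smul_set hz))
      hY M p hp hpp w
      (by
        intro l hlw
        rcases hl l hlw with h | h
        · rcases h with (h | h) | ⟨i, h⟩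
          · exact ⟨true, Or.inl h⟩
          · exact ⟨false, Or.inl h⟩
          · exact ⟨true, Or.inr (Or.inr ⟨i, by simp [girthD, ρ, g, ← h]⟩)⟩
        · rcases h with (h | h) | ⟨i, h⟩
          · exact ⟨true, Or.inr (Or.inl (by rw [← inv_inv l, h]; rfl))⟩
          · exact ⟨false, Or.inr (Or.inl (by
              rw [← inv_inv l, Set.mem_singleton_iff.1 h]; rfl))⟩
          · refine ⟨false, Or.inr (Or.inr ⟨i, ?_⟩)⟩
            rw [← inv_inv l, ← h]
            simp [girthD, ρ, g, mul_assoc])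
      hch hlen
    rcases key with h | ⟨h, t, rfl, b, a, c, y, hy, hpx, ha, hc, -, -⟩
    · exact hw h
    · have hac : a + c ≠ 0 := by
        rcases hc with ⟨rfl, h0⟩ | ⟨i, rfl, -⟩
        · simpa using h0
        · have h5 : (M : ℤ) < p i := by exact_mod_cast hp i
          have h6 : ((h :: t).length : ℤ) < M := by exact_mod_cast hlen
          have := abs_le.1 ha
          omega
      have hxU : x ∈ U b := by
        have := hY b _ hac y hy
        rwa [← hpx, hprod, one_smul] at this
      apply h1
      left
      cases b
      · exact Or.inr hxU
      · exact Or.inl hxU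
  refine ⟨?_, main, ?_⟩
  · rw [eq_top_iff, ← hgen, Subgroup.closure_le]
    rintro _ ⟨i, rfl⟩
    have hσ : σ ∈ Subgroup.closure S := Subgroup.subset_closure (Or.inl (Or.inl rfl))
    have hτ : τ ∈ Subgroup.closure S := Subgroup.subset_closure (Or.inl (Or.inr rfl))
    have hδ : σ ^ p i * γ i * (τ ^ p i)⁻¹ ∈ Subgroup.closure S :=
      Subgroup.subset_closure (Or.inr ⟨i, rfl⟩)
    have h := mul_mem (mul_mem (inv_mem (pow_mem hσ (p i))) hδ) (pow_mem hτ (p i))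
    have e : (σ ^ p i)⁻¹ * (σ ^ p i * γ i * (τ ^ p i)⁻¹) * τ ^ p i = γ i := by group
    rwa [e] at h
  · refine le_iInf₂ ?_
    rintro w ⟨hw, hl, hch, hprod⟩
    by_contra hcon
    exact main w hw hl hch (by exact_mod_cast not_le.1 hcon) hprod
end

section
/- Tits alternative: Let k be a field, let n ≥ 1, and let Γ be a finitely generated subgroup of GL(n, k). Then exactly one of the following holds: either Γ contains a subgroup isomorphic to the free group of rank 2, or Γ is virtually solvable. -/
set_option linter.style.haveILetI false


/-- combinatorial ping-pong -/
theorem tits_free_of_pingpong {ι G α : Type*} [Group G] (act : G → α → α)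
    (hmul : ∀ g h w, act (g * h) w = act g (act h w)) (hone : ∀ w, act 1 w = w)
    (a : ι → G) (U : ι × Bool → Set α) (w0 : α) (hw0 : ∀ s, w0 ∉ U s)
    (h0 : ∀ s : ι × Bool, act (cond s.2 (a s.1) (a s.1)⁻¹) w0 ∈ U s)
    (h1 : ∀ s t : ι × Bool, t ≠ (s.1, !s.2) → ∀ w ∈ U t, act (cond s.2 (a s.1) (a s.1)⁻¹) w ∈ U s) :
    Function.Injective (FreeGroup.lift a) := by
  classical
  have key : ∀ (L : List (ι × Bool)) (s : ι × Bool), FreeGroup.IsReduced (s :: L) →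
      act (((s :: L).map fun x => cond x.2 (a x.1) (a x.1)⁻¹).prod) w0 ∈ U s := by
    intro L
    induction L with
    | nil => intro s _; simpa using h0 s
    | cons t L ih =>
      intro s hs
      rw [List.map_cons, List.prod_cons, hmul]
      rw [FreeGroup.IsReduced, List.isChain_cons_cons] at hs
      refine h1 s t ?_ _ (ih t hs.2)
      rintro rfl
      have := hs.1 rfl
      cases h : s.2 <;> simp [h] at this
  rw [injective_iff_map_eq_one]
  intro x hx
  by_contra hne
  have hne' : x.toWord ≠ [] := by rwa [Ne, FreeGroup.toWord_eq_nil_iff]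
  obtain ⟨s, L, hL⟩ := List.exists_cons_of_ne_nil hne'
  have hred : FreeGroup.IsReduced (s :: L) := hL ▸ FreeGroup.isReduced_toWord
  have := key L s hred
  rw [← FreeGroup.lift_mk, ← hL, FreeGroup.mk_toWord, hx, hone] at this
  exact hw0 s this

theorem tits_analytic_pingpong {F W G : Type*} [NontriviallyNormedField F] [CompleteSpace F]
    [NormedAddCommGroup W] [NormedSpace F W] [FiniteDimensional F W] [Group G]
    (ρ : G →* (W →L[F] W)) (P : Fin 2 × Bool → (W →L[F] W)) (hP0 : ∀ s, P s ≠ 0)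
    (hPr : ∀ s, LinearMap.range (P s : W →ₗ[F] W) ≠ ⊤)
    (hP : ∀ δ : ℝ, 0 < δ → ∃ a : Fin 2 → G, ∀ s : Fin 2 × Bool, ∃ c : F,
      ‖c • ρ (cond s.2 (a s.1) (a s.1)⁻¹) - P s‖ < δ)
    (hinj : ∀ s t : Fin 2 × Bool, t ≠ (s.1, !s.2) →
      ∀ u ∈ LinearMap.range (P t : W →ₗ[F] W), P s u = 0 → u = 0) :
    ∃ a : Fin 2 → G, Function.Injective (FreeGroup.lift a) := by
  classical
  -- base point
  obtain ⟨w0, hw0⟩ : ∃ w0 : W, ∀ s, w0 ∉ LinearMap.range (P s : W →ₗ[F] W) ∧ P s w0 ≠ 0 := by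
    let p : (Fin 2 × Bool) × Bool → Submodule F W := fun s =>
      cond s.2 (LinearMap.range (P s.1 : W →ₗ[F] W)) (LinearMap.ker (P s.1 : W →ₗ[F] W))
    have : Infinite F := NontriviallyNormedField.infinite F
    have hp : (⋃ q ∈ (Finset.univ.image p), (q : Set W)) ≠ Set.univ := by
      apply Subspace.biUnion_ne_univ_of_top_notMem
      rintro h
      simp only [Finset.mem_image, Finset.mem_univ, true_and, p] at h
      obtain ⟨⟨s, b⟩, h⟩ := h
      cases b
      · apply hP0 s
        simp only [cond_false, LinearMap.ker_eq_top] at h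
        ext x
        exact congrArg (fun f : W →ₗ[F] W => f x) h
      · exact hPr s h
    rw [Set.ne_univ_iff_exists_notMem] at hp
    obtain ⟨w0, hw0⟩ := hp
    have hw1 : ∀ s, w0 ∉ p s := fun s hs => hw0 (Set.mem_biUnion
      (Finset.mem_coe.2 (Finset.mem_image_of_mem p (Finset.mem_univ s))) hs)
    exact ⟨w0, fun s => ⟨hw1 (s, true), hw1 (s, false)⟩⟩
  have hw0' : w0 ≠ 0 := by
    rintro rfl
    exact (hw0 default).2 (map_zero _)
  have hw0n : 0 < ‖w0‖ := norm_pos_iff.2 hw0'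
  -- constants
  have hc1 : ∀ᶠ c in nhdsWithin (0:ℝ) (Set.Ioi 0), ∀ s t : Fin 2 × Bool, t ≠ (s.1, !s.2) →
      ∀ u ∈ LinearMap.range (P t : W →ₗ[F] W), c * ‖u‖ ≤ ‖P s u‖ := by
    rw [Filter.eventually_all]
    intro s
    rw [Filter.eventually_all]
    intro t
    by_cases hst : t ≠ (s.1, !s.2)
    swap
    · simp [hst]
    let f : LinearMap.range (P t : W →ₗ[F] W) →ₗ[F] W :=
      (P s : W →ₗ[F] W) ∘ₗ (LinearMap.range (P t : W →ₗ[F] W)).subtype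
    have hf : LinearMap.ker f = ⊥ := by
      rw [LinearMap.ker_eq_bot']
      intro u hu
      exact Subtype.ext (hinj s t hst u u.2 hu)
    obtain ⟨K, hK, hKf⟩ := f.exists_antilipschitzWith hf
    have hKpos : (0:ℝ) < (K:ℝ)⁻¹ := by positivity
    filter_upwards [Ioo_mem_nhdsGT hKpos] with c hc hst' u hu
    have h2 := hKf.le_mul_dist ⟨u, hu⟩ 0
    simp only [map_zero, dist_zero_right] at h2
    have h3 : ‖u‖ ≤ K * ‖P s u‖ := h2
    have hK' : (0:ℝ) < K := hK
    calc c * ‖u‖ ≤ (K:ℝ)⁻¹ * (K * ‖P s u‖) := by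
            apply mul_le_mul hc.2.le h3 (norm_nonneg _) hKpos.le
      _ = ‖P s u‖ := by field_simp
  have hc2 : ∀ᶠ c in nhdsWithin (0:ℝ) (Set.Ioi 0), ∀ s : Fin 2 × Bool, c * ‖w0‖ ≤ ‖P s w0‖ := by
    rw [Filter.eventually_all]
    intro s
    have : 0 < ‖P s w0‖ / ‖w0‖ := div_pos (norm_pos_iff.2 (hw0 s).2) hw0n
    filter_upwards [Ioo_mem_nhdsGT this] with c hc
    exact (le_div_iff₀ hw0n).1 hc.2.le
  obtain ⟨c, ⟨hc1, hc2⟩, hc⟩ := ((hc1.and hc2).and self_mem_nhdsWithin).exists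
  have hcpos : 0 < c := hc
  obtain ⟨M, hM⟩ : ∃ M : ℝ, ∀ s, ‖P s‖ ≤ M := by
    obtain ⟨M, hM⟩ := (Set.finite_range fun s => ‖P s‖).bddAbove
    exact ⟨M, fun s => hM ⟨s, rfl⟩⟩
  have hM0 : 0 ≤ M := (norm_nonneg _).trans (hM default)
  have he1 : ∀ᶠ ε in nhdsWithin (0:ℝ) (Set.Ioi 0), ∀ s : Fin 2 × Bool,
      ∀ u ∈ LinearMap.range (P s : W →ₗ[F] W), ε * ‖w0‖ < ‖w0 - u‖ := by
    rw [Filter.eventually_all]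
    intro s
    have hcl : IsClosed (LinearMap.range (P s : W →ₗ[F] W) : Set W) :=
      Submodule.closed_of_finiteDimensional _
    have hpos : 0 < Metric.infDist w0 (LinearMap.range (P s : W →ₗ[F] W) : Set W) :=
      (hcl.notMem_iff_infDist_pos ⟨0, Submodule.zero_mem _⟩).1 (hw0 s).1
    filter_upwards [Ioo_mem_nhdsGT (div_pos hpos hw0n)] with ε hε u hu
    calc ε * ‖w0‖ < Metric.infDist w0 (LinearMap.range (P s : W →ₗ[F] W) : Set W) :=
            (lt_div_iff₀ hw0n).1 hε.2
      _ ≤ dist w0 u := Metric.infDist_le_dist_of_mem hu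
      _ = ‖w0 - u‖ := dist_eq_norm _ _
  have hb : 0 < min 1 (c / 2 / (c + M)) := by positivity
  obtain ⟨ε, ⟨he1, he2⟩, he⟩ := ((he1.and (Ioo_mem_nhdsGT hb)).and self_mem_nhdsWithin).exists
  have hepos : 0 < ε := he
  have he3 : ε ≤ 1 := (he2.2.trans_le (min_le_left _ _)).le
  have he4 : (c + M) * ε ≤ c / 2 := by
    have := (he2.2.trans_le (min_le_right _ _)).le
    rw [le_div_iff₀ (by positivity)] at this
    linarith
  obtain ⟨a, ha⟩ := hP (ε * c / 4) (by positivity)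
  refine ⟨a, tits_free_of_pingpong (fun g w => ρ g w) (by intros; simp) (by simp) a
    (fun s => {w | w ≠ 0 ∧ ∃ u ∈ LinearMap.range (P s : W →ₗ[F] W), ‖w - u‖ ≤ ε * ‖w‖}) w0 ?_ ?_ ?_⟩
  · rintro s ⟨-, u, hu, h⟩
    exact absurd h (not_le.2 (he1 s u hu))
  all_goals
    have key : ∀ s, ∀ w : W, w ≠ 0 → c / 2 * ‖w‖ ≤ ‖P s w‖ →
        ρ (cond s.2 (a s.1) (a s.1)⁻¹) w ≠ 0 ∧ ∃ u ∈ LinearMap.range (P s : W →ₗ[F] W),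
          ‖ρ (cond s.2 (a s.1) (a s.1)⁻¹) w - u‖ ≤ ε * ‖ρ (cond s.2 (a s.1) (a s.1)⁻¹) w‖ := by
      intro s w hw hPw
      obtain ⟨d, hd⟩ := ha s
      set T := ρ (cond s.2 (a s.1) (a s.1)⁻¹) with hT
      have hwn : 0 < ‖w‖ := norm_pos_iff.2 hw
      have h1 : ‖d • T w - P s w‖ ≤ ε * c / 4 * ‖w‖ := by
        have := (d • T - P s).le_opNorm w
        refine this.trans ?_
        gcongr
      have h2 : ‖P s w‖ ≤ ‖d • T w‖ + ‖d • T w - P s w‖ := by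
        have := norm_sub_le (d • T w) (d • T w - P s w)
        simpa using this
      have h3 : ε * c / 4 * ‖w‖ ≤ c / 4 * ‖w‖ := by
        gcongr
        nlinarith
      have h4 : c / 4 * ‖w‖ ≤ ‖d • T w‖ := by linarith
      have h4' : 0 < ‖d • T w‖ := lt_of_lt_of_le (by positivity) h4
      have hdT : d • T w ≠ 0 := norm_pos_iff.1 h4'
      have hd0 : d ≠ 0 := fun h => hdT (by simp [h])
      refine ⟨fun h => hdT (by rw [h, smul_zero]), d⁻¹ • P s w, ⟨d⁻¹ • w, by simp⟩, ?_⟩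
      have h5 : T w - d⁻¹ • P s w = d⁻¹ • (d • T w - P s w) := by
        rw [smul_sub, inv_smul_smul₀ hd0]
      have h6 : ‖T w‖ = ‖d⁻¹‖ * ‖d • T w‖ := by
        rw [← norm_smul, inv_smul_smul₀ hd0]
      rw [h5, norm_smul, h6]
      have h7 : ‖d • T w - P s w‖ ≤ ε * ‖d • T w‖ := by
        calc _ ≤ ε * (c / 4 * ‖w‖) := by linarith
          _ ≤ _ := by gcongr
      calc _ ≤ ‖d⁻¹‖ * (ε * ‖d • T w‖) := by gcongr
        _ = _ := by ring
  · intro s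
    refine key s w0 hw0' (le_trans ?_ (hc2 s))
    gcongr
    linarith
  · rintro s t hst w ⟨hw, u, hu, h⟩
    refine key s w hw ?_
    have h1 := hc1 s t hst u hu
    have h2 : ‖P s w - P s u‖ ≤ M * (ε * ‖w‖) := by
      rw [← map_sub]
      refine ((P s).le_opNorm _).trans ?_
      gcongr
      exact hM s
    have h3 : ‖P s u‖ ≤ ‖P s w‖ + ‖P s w - P s u‖ := by
      have := norm_sub_le (P s w) (P s w - P s u)
      simpa using this
    have h4 : ‖w‖ ≤ ‖u‖ + ‖w - u‖ := by
      have := norm_add_le u (w - u)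
      simpa using this
    have h5 : c * (‖w‖ - ε * ‖w‖) ≤ c * ‖u‖ := by
      gcongr
      linarith
    have h6 : (c + M) * ε * ‖w‖ ≤ c / 2 * ‖w‖ := by gcongr
    nlinarith


section
variable {F W G : Type*} [NontriviallyNormedField F]
    [NormedAddCommGroup W] [NormedSpace F W] [FiniteDimensional F W] [Group G]

/-- rank of an operator -/
noncomputable def titsRk (T : W →L[F] W) : ℕ := Module.finrank F (LinearMap.range (T : W →ₗ[F] W))

theorem titsRk_mul_left (A B : W →L[F] W) : titsRk (A * B) ≤ titsRk A := by
  apply Submodule.finrank_mono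
  rintro _ ⟨x, rfl⟩
  exact ⟨B x, rfl⟩

theorem titsRk_mul_right (A B : W →L[F] W) : titsRk (A * B) ≤ titsRk B := by
  have : LinearMap.range ((A * B : W →L[F] W) : W →ₗ[F] W)
      = (LinearMap.range (B : W →ₗ[F] W)).map (A : W →ₗ[F] W) := by
    rw [← LinearMap.range_comp]; rfl
  unfold titsRk
  rw [this]
  exact Submodule.finrank_map_le _ _

theorem titsRk_inj (A B : W →L[F] W) (h : titsRk B ≤ titsRk (A * B)) :
    ∀ u ∈ LinearMap.range (B : W →ₗ[F] W), A u = 0 → u = 0 := by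
  let f : LinearMap.range (B : W →ₗ[F] W) →ₗ[F] W :=
      (A : W →ₗ[F] W) ∘ₗ (LinearMap.range (B : W →ₗ[F] W)).subtype
  have h1 : LinearMap.range f = LinearMap.range ((A * B : W →L[F] W) : W →ₗ[F] W) := by
    ext x
    constructor
    · rintro ⟨⟨_, y, rfl⟩, rfl⟩
      exact ⟨y, rfl⟩
    · rintro ⟨y, rfl⟩
      exact ⟨⟨B y, y, rfl⟩, rfl⟩
  have h2 := LinearMap.finrank_range_add_finrank_ker f
  have h3 : Module.finrank F (LinearMap.range f) = titsRk (A * B) := by rw [h1]; rfl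
  have h4 : Module.finrank F (LinearMap.ker f) = 0 := by
    unfold titsRk at *
    omega
  have h5 : LinearMap.ker f = ⊥ := Submodule.finrank_eq_zero.1 h4
  intro u hu hAu
  have : (⟨u, hu⟩ : LinearMap.range (B : W →ₗ[F] W)) ∈ LinearMap.ker f := hAu
  rw [h5, Submodule.mem_bot] at this
  exact congrArg Subtype.val this

theorem tits_dynamics [ProperSpace F] (ρ : G →* (W →L[F] W))
    (gen : ∀ l : List ((W →L[F] W) × (W →L[F] W)), (∀ x ∈ l, x.1 ≠ 0 ∧ x.2 ≠ 0) →
      ∃ h : G, ∀ x ∈ l, x.1 * ρ h * x.2 ≠ 0 ∧ x.1 * ρ h⁻¹ * x.2 ≠ 0)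
    (y0 : W →L[F] W) (hy0 : y0 ∈ closure {T : W →L[F] W | ∃ (c : F) (h : G), T = c • ρ h})
    (hy00 : y0 ≠ 0) (hy0r : LinearMap.range (y0 : W →ₗ[F] W) ≠ ⊤) :
    ∃ a : Fin 2 → G, Function.Injective (FreeGroup.lift a) := by
  classical
  have : CompleteSpace F := inferInstance
  set S0 : Set (W →L[F] W) := {T : W →L[F] W | ∃ (c : F) (h : G), T = c • ρ h} with hS0
  set Z0 : Set ((W →L[F] W) × (W →L[F] W)) :=
    {x | ∃ (c c' : F) (h : G), x = (c • ρ h, c' • ρ h⁻¹)} with hZ0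
  have hSmul : ∀ A ∈ closure S0, ∀ B ∈ closure S0, A * B ∈ closure S0 := by
    intro A hA B hB
    refine map_mem_closure₂ continuous_mul hA hB ?_
    rintro _ ⟨c, h, rfl⟩ _ ⟨c', h', rfl⟩
    exact ⟨c * c', h * h', by rw [smul_mul_smul_comm, map_mul]⟩
  have hρS : ∀ h, ρ h ∈ closure S0 := fun h => subset_closure ⟨1, h, by simp⟩
  have hZ1 : ∀ x ∈ closure Z0, x.1 ∈ closure S0 := by
    intro x hx
    refine map_mem_closure continuous_fst hx ?_
    rintro _ ⟨c, c', h, rfl⟩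
    exact ⟨c, h, rfl⟩
  have hZ2 : ∀ x ∈ closure Z0, x.2 ∈ closure S0 := by
    intro x hx
    refine map_mem_closure continuous_snd hx ?_
    rintro _ ⟨c, c', h, rfl⟩
    exact ⟨c', h⁻¹, rfl⟩
  -- minimal rank element
  obtain ⟨y, ⟨hyS, hy⟩, hmin⟩ := (measure (titsRk (F := F) (W := W))).wf.has_min
    {T | T ∈ closure S0 ∧ T ≠ 0} ⟨y0, hy0, hy00⟩
  replace hmin : ∀ T ∈ closure S0, T ≠ 0 → titsRk y ≤ titsRk T := fun T h1 h2 =>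
    not_lt.1 (hmin T ⟨h1, h2⟩)
  have hylt : titsRk y < Module.finrank F W :=
    (hmin y0 hy0 hy00).trans_lt (Submodule.finrank_lt hy0r)
  have hρ0 : ∀ h, ρ h ≠ 0 := by
    intro h h0
    apply hy
    have h1 : ρ 1 = 0 := by rw [← mul_inv_cancel h, map_mul, h0, zero_mul]
    rw [map_one] at h1
    rw [← mul_one y, h1, mul_zero]
  -- the inverse sequence
  obtain ⟨z, hz, hyz⟩ : ∃ z : W →L[F] W, z ≠ 0 ∧ (y, z) ∈ closure Z0 := by
    obtain ⟨u, huS, hu⟩ := mem_closure_iff_seq_limit.1 hyS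
    choose c h hch using huS
    obtain ⟨κ, hκ⟩ := NormedField.exists_one_lt_norm F
    have hresc : ∀ n, ∃ d : F, ‖d • ρ (h n)⁻¹‖ < 1 ∧ 1 / ‖κ‖ ≤ ‖d • ρ (h n)⁻¹‖ := by
      intro n
      obtain ⟨d, -, h1, h2, -⟩ := rescale_to_shell hκ one_pos (hρ0 (h n)⁻¹)
      exact ⟨d, h1, h2⟩
    choose d hd1 hd2 using hresc
    have : ProperSpace (W →L[F] W) := FiniteDimensional.proper F _
    obtain ⟨z, -, φ, hφ, hz⟩ := tendsto_subseq_of_bounded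
      (Metric.isBounded_ball (x := (0 : W →L[F] W)) (r := 1))
      (x := fun n => d n • ρ (h n)⁻¹) (by intro n; simpa using hd1 n)
    refine ⟨z, ?_, ?_⟩
    · have h3 : 1 / ‖κ‖ ≤ ‖z‖ := by
        refine ge_of_tendsto' hz.norm (fun n => hd2 _)
      have : 0 < ‖z‖ := lt_of_lt_of_le (by positivity) h3
      exact norm_pos_iff.1 this
    · refine mem_closure_of_tendsto ((hu.comp hφ.tendsto_atTop).prodMk_nhds hz) ?_
      refine Filter.Eventually.of_forall fun n => ⟨c (φ n), d (φ n), h (φ n), ?_⟩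
      simp [hch]
  have hzS := hZ2 _ hyz
  obtain ⟨a, ha⟩ := gen [(y, z)] (by simp [hy, hz])
  simp only [List.mem_singleton, forall_eq] at ha
  set p := y * ρ a * z with hp
  set q := y * ρ a⁻¹ * z with hq
  have hpq : (p, q) ∈ closure Z0 := by
    have hcont : Continuous fun x : (W →L[F] W) × (W →L[F] W) =>
        (x.1 * ρ a * x.2, x.1 * ρ a⁻¹ * x.2) := by fun_prop
    refine (fun hm => map_mem_closure (t := Z0) hcont hyz hm) ?_
    rintro _ ⟨c, c', h, rfl⟩
    refine ⟨c * c', c * c', h * a * h⁻¹, ?_⟩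
    simp only [map_mul, mul_inv_rev, inv_inv, mul_assoc, smul_mul_assoc, mul_smul_comm, smul_smul,
      mul_comm c c']
  have hprk : titsRk p ≤ titsRk y := by
    rw [hp, mul_assoc]; exact titsRk_mul_left _ _
  have hqrk : titsRk q ≤ titsRk y := by
    rw [hq, mul_assoc]; exact titsRk_mul_left _ _
  obtain ⟨b, hb⟩ := gen [(p, p), (q, q)] (by simp [ha.1, ha.2])
  simp only [List.mem_cons, List.not_mem_nil, or_false, forall_eq_or_imp, forall_eq] at hb
  obtain ⟨⟨hb1, -⟩, -, hb2⟩ := hb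
  set P := p * ρ b with hPdef
  set Q := ρ b⁻¹ * q with hQdef
  have hPQ : (P, Q) ∈ closure Z0 := by
    have hcont : Continuous fun x : (W →L[F] W) × (W →L[F] W) =>
        (x.1 * ρ b, ρ b⁻¹ * x.2) := by fun_prop
    refine (fun hm => map_mem_closure (t := Z0) hcont hpq hm) ?_
    rintro _ ⟨c, c', h, rfl⟩
    refine ⟨c, c', h * b, ?_⟩
    ext1 <;> simp
  have hPrk : titsRk P ≤ titsRk y := (titsRk_mul_left _ _).trans hprk
  have hQrk : titsRk Q ≤ titsRk y := (titsRk_mul_right _ _).trans hqrk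
  have hbb : ρ b * ρ b⁻¹ = 1 := by rw [← map_mul]; simp
  have hbb' : ρ b⁻¹ * ρ b = 1 := by rw [← map_mul]; simp
  have hPP : P * P ≠ 0 := by
    intro h
    apply hb1
    calc p * ρ b * p = (P * P) * ρ b⁻¹ := by rw [hPdef]; simp only [mul_assoc, hbb, mul_one]
      _ = 0 := by rw [h, zero_mul]
  have hQQ : Q * Q ≠ 0 := by
    intro h
    apply hb2
    calc q * ρ b⁻¹ * q = ρ b * (Q * Q) := by
          rw [hQdef]; simp only [← mul_assoc, hbb, one_mul]
      _ = 0 := by rw [h, mul_zero]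
  have hP0 : P ≠ 0 := fun h => hPP (by rw [h, zero_mul])
  have hQ0 : Q ≠ 0 := fun h => hQQ (by rw [h, zero_mul])
  obtain ⟨e, he⟩ := gen [(P, P), (P, Q), (Q, P), (Q, Q)] (by simp [hP0, hQ0])
  simp only [List.mem_cons, List.not_mem_nil, or_false, forall_eq_or_imp, forall_eq] at he
  obtain ⟨he1, he2, he3, he4⟩ := he
  have hdiff : ∀ b b' : Bool, cond b P Q * ρ e * cond b' P Q ≠ 0 ∧
      cond b P Q * ρ e⁻¹ * cond b' P Q ≠ 0 := by
    intro b b'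
    cases b <;> cases b'
    · exact he4
    · exact he3
    · exact he2
    · exact he1
  have hsame : ∀ b : Bool, cond b P Q * cond b P Q ≠ 0 := by
    intro b
    cases b
    · exact hQQ
    · exact hPP
  clear he1 he2 he3 he4
  clear_value P Q p q
  let u : Fin 2 → G := ![1, e]
  let Φ : Fin 2 × Bool → (W →L[F] W) × (W →L[F] W) → (W →L[F] W) := fun s x =>
    ρ (u s.1) * (cond s.2 x.1 x.2) * ρ (u s.1)⁻¹
  have hΦc : ∀ s, Continuous (Φ s) := by
    rintro ⟨i, b⟩
    cases b <;> simp only [Φ, cond_true, cond_false] <;> fun_prop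
  have huu : ∀ i, ρ (u i) * ρ (u i)⁻¹ = 1 := by intro i; rw [← map_mul]; simp
  have huu' : ∀ i, ρ (u i)⁻¹ * ρ (u i) = 1 := by intro i; rw [← map_mul]; simp
  have hΦS : ∀ s, Φ s (P, Q) ∈ closure S0 := by
    rintro ⟨i, b⟩
    refine hSmul _ (hSmul _ (hρS _) _ ?_) _ (hρS _)
    cases b
    · exact hZ2 _ hPQ
    · exact hZ1 _ hPQ
  have hΦrk : ∀ s, titsRk (Φ s (P, Q)) ≤ titsRk y := by
    rintro ⟨i, b⟩
    refine (titsRk_mul_left _ _).trans ((titsRk_mul_right _ _).trans ?_)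
    cases b
    · exact hQrk
    · exact hPrk
  have hmul0 : ∀ s t : Fin 2 × Bool, t ≠ (s.1, !s.2) → Φ s (P, Q) * Φ t (P, Q) ≠ 0 := by
    intro s t hst h0
    have h1 : (cond s.2 P Q) * ρ ((u s.1)⁻¹ * u t.1) * (cond t.2 P Q) = 0 := by
      calc _ = ρ (u s.1)⁻¹ * (Φ s (P, Q) * Φ t (P, Q)) * ρ (u t.1) := by
            simp only [Φ, map_mul, mul_assoc, huu', mul_one]
            simp only [← mul_assoc, huu', one_mul]
        _ = 0 := by rw [h0, mul_zero, zero_mul]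
    obtain ⟨i, b⟩ := s
    obtain ⟨j, b'⟩ := t
    have hcase : b ≠ b' → i ≠ j := by
      rintro hb rfl
      apply hst
      cases b <;> cases b' <;> first | rfl | exact absurd rfl hb
    rcases eq_or_ne i j with rfl | hij
    · have hbb : b = b' := by
        by_contra hb
        exact hcase hb rfl
      subst hbb
      simp only [inv_mul_cancel, map_one, mul_one] at h1
      exact hsame b h1
    · have h3 : (u i)⁻¹ * u j = e ∨ (u i)⁻¹ * u j = e⁻¹ := by
        fin_cases i <;> fin_cases j
        · exact absurd rfl hij
        · left; simp [u]
        · right; simp [u]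
        · exact absurd rfl hij
      rcases h3 with h3 | h3
      · simp only [h3] at h1
        exact (hdiff b b').1 h1
      · simp only [h3] at h1
        exact (hdiff b b').2 h1
  have hne : ∀ s, Φ s (P, Q) ≠ 0 := by
    rintro ⟨i, b⟩ h
    refine hmul0 (i, b) (i, b) ?_ (by rw [h, zero_mul])
    cases b <;> simp
  refine tits_analytic_pingpong ρ (fun s => Φ s (P, Q)) hne ?_ ?_ ?_
  · intro s hs
    have := hΦrk s
    unfold titsRk at this hylt
    rw [hs, finrank_top] at this
    omega
  · intro δ hδ
    have hopen : {x : (W →L[F] W) × (W →L[F] W) | ∀ s, ‖Φ s x - Φ s (P, Q)‖ < δ} ∈ nhds (P, Q) := by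
      have : ∀ᶠ x in nhds (P, Q), ∀ s, ‖Φ s x - Φ s (P, Q)‖ < δ := by
        rw [Filter.eventually_all]
        intro s
        have := (hΦc s).tendsto (P, Q)
        have := (Metric.tendsto_nhds.1 this) δ hδ
        simpa only [dist_eq_norm] using this
      exact this
    obtain ⟨x, hx, c, c', h, rfl⟩ := mem_closure_iff_nhds.1 hPQ _ hopen
    refine ⟨fun i => u i * h * (u i)⁻¹, ?_⟩
    rintro ⟨i, b⟩
    have := hx (i, b)
    cases b
    · refine ⟨c', ?_⟩
      simpa [Φ, mul_assoc] using this
    · refine ⟨c, ?_⟩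
      simpa [Φ, mul_assoc] using this
  · intro s t hst
    apply titsRk_inj
    exact (hΦrk t).trans (hmin _ (hSmul _ (hΦS s) _ (hΦS t)) (hmul0 s t hst))
end


section
variable {F W G : Type*} [NontriviallyNormedField F]
    [NormedAddCommGroup W] [NormedSpace F W] [FiniteDimensional F W] [Group G]

theorem tits_gen_of_irr (ρ : G →* (W →L[F] W)) (A : Subalgebra F (G → F))
    (hdom : ∀ f ∈ A, ∀ g ∈ A, f * g = 0 → f = 0 ∨ g = 0)
    (hinv : ∀ f ∈ A, (fun h => f h⁻¹) ∈ A)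
    (hpoly : ∀ (φ : W →ₗ[F] F) (v : W), (fun h => φ (ρ h v)) ∈ A)
    (irr : ∀ U : Submodule F W, (∀ h, ∀ u ∈ U, ρ h u ∈ U) → U = ⊥ ∨ U = ⊤)
    (l : List ((W →L[F] W) × (W →L[F] W))) (hl : ∀ x ∈ l, x.1 ≠ 0 ∧ x.2 ≠ 0) :
      ∃ h : G, ∀ x ∈ l, x.1 * ρ h * x.2 ≠ 0 ∧ x.1 * ρ h⁻¹ * x.2 ≠ 0 := by
  have key : ∀ P Q : W →L[F] W, P ≠ 0 → Q ≠ 0 → ∃ f ∈ A, f ≠ 0 ∧ ∀ h, f h ≠ 0 → P * ρ h * Q ≠ 0 := by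
    intro P Q hP hQ
    obtain ⟨w, hw⟩ : ∃ w, Q w ≠ 0 := by
      by_contra! h; exact hQ (ContinuousLinearMap.ext h)
    obtain ⟨v, hv⟩ : ∃ w, P w ≠ 0 := by
      by_contra! h; exact hP (ContinuousLinearMap.ext h)
    obtain ⟨φ, hφ⟩ : ∃ φ : Module.Dual F W, φ (P v) ≠ 0 := by
      by_contra! h; exact hv ((Module.forall_dual_apply_eq_zero_iff F _).1 h)
    refine ⟨fun h => φ (P (ρ h (Q w))), hpoly (φ ∘ₗ (P : W →ₗ[F] W)) (Q w), ?_, ?_⟩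
    · intro h0
      let U : Submodule F W := Submodule.span F (Set.range fun h => ρ h (Q w))
      have hU : U = ⊥ ∨ U = ⊤ := by
        apply irr
        intro h u hu
        induction hu using Submodule.span_induction with
        | mem x hx =>
          obtain ⟨g, rfl⟩ := hx
          apply Submodule.subset_span
          exact ⟨h * g, by simp⟩
        | zero => simp
        | add x y _ _ hx hy => rw [map_add]; exact U.add_mem hx hy
        | smul c x _ hx => rw [map_smul]; exact U.smul_mem c hx
      have hm : Q w ∈ U := Submodule.subset_span ⟨1, by simp⟩
      rcases hU with hU | hU
      · rw [hU] at hm; exact hw (by simpa using hm)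
      · have hle : U ≤ LinearMap.ker (φ ∘ₗ (P : W →ₗ[F] W)) := by
          rw [Submodule.span_le]
          rintro _ ⟨h, rfl⟩
          exact congrFun h0 h
        rw [hU] at hle
        exact hφ (hle (Submodule.mem_top : v ∈ ⊤))
    · intro h hh h0
      apply hh
      have : (P * ρ h * Q) w = 0 := by rw [h0]; rfl
      have h2 : P (ρ h (Q w)) = 0 := this
      simp [h2]
  have key2 : ∃ f ∈ A, f ≠ 0 ∧ ∀ h, f h ≠ 0 → ∀ x ∈ l, x.1 * ρ h * x.2 ≠ 0 := by
    induction l with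
    | nil => exact ⟨1, A.one_mem, one_ne_zero, by simp⟩
    | cons a l ih =>
      obtain ⟨f, hf, hf0, hff⟩ := ih (fun x hx => hl x (by simp [hx]))
      obtain ⟨g, hg, hg0, hgg⟩ := key a.1 a.2 (hl a (by simp)).1 (hl a (by simp)).2
      refine ⟨f * g, A.mul_mem hf hg, ?_, ?_⟩
      · intro h; rcases hdom f hf g hg h with h | h <;> contradiction
      · intro h hh x hx
        simp only [Pi.mul_apply, ne_eq, mul_eq_zero, not_or] at hh
        rcases List.mem_cons.1 hx with rfl | hx
        · exact hgg h hh.2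
        · exact hff h hh.1 x hx
  obtain ⟨f, hf, hf0, hff⟩ := key2
  have h1 : f * (fun h => f h⁻¹) ≠ 0 := by
    intro h; rcases hdom f hf _ (hinv f hf) h with h | h
    · contradiction
    · apply hf0; ext x; simpa using congrFun h x⁻¹
  obtain ⟨h, hh⟩ : ∃ h, (f * (fun h => f h⁻¹)) h ≠ 0 := by
    by_contra! h; exact h1 (funext h)
  simp only [Pi.mul_apply, ne_eq, mul_eq_zero, not_or] at hh
  exact ⟨h, fun x hx => ⟨hff h hh.1 x hx, hff _ hh.2 x hx⟩⟩

theorem tits_irr [ProperSpace F] (ρ : G →* (W →L[F] W)) (A : Subalgebra F (G → F))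
    (hdom : ∀ f ∈ A, ∀ g ∈ A, f * g = 0 → f = 0 ∨ g = 0)
    (hinv : ∀ f ∈ A, (fun h => f h⁻¹) ∈ A)
    (hpoly : ∀ (φ : W →ₗ[F] F) (v : W), (fun h => φ (ρ h v)) ∈ A)
    (irr : ∀ U : Submodule F W, (∀ h, ∀ u ∈ U, ρ h u ∈ U) → U = ⊥ ∨ U = ⊤)
    (d : G) (hd : d ∈ commutator G) (lam : F) (hlam : 1 < ‖lam‖) (v : W) (hv : v ≠ 0)
    (hdv : ρ d v = lam • v) :
    ∃ a : Fin 2 → G, Function.Injective (FreeGroup.lift a) := by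
  have hdet : ∀ m : ℕ, LinearMap.det ((ρ (d ^ m) : W →L[F] W) : W →ₗ[F] W) = 1 := by
    intro m
    let D : G →* Fˣ := MonoidHom.toHomUnits
      { toFun := fun g => LinearMap.det ((ρ g : W →L[F] W) : W →ₗ[F] W)
        map_one' := by rw [map_one]; exact LinearMap.det_id
        map_mul' := by
          intro x y; rw [map_mul]
          exact LinearMap.det_comp _ _ }
    have h1 : D d = 1 := Abelianization.commutator_subset_ker D hd
    have h2 : D (d ^ m) = 1 := by rw [map_pow, h1, one_pow]
    exact congrArg Units.val h2
  have hpow : ∀ m : ℕ, ρ (d ^ m) v = lam ^ m • v := by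
    intro m
    induction m with
    | zero => simp
    | succ m ih =>
      rw [pow_succ, map_mul]
      change ρ (d ^ m) (ρ d v) = _
      rw [hdv, map_smul, ih, smul_smul, pow_succ, mul_comm]
  have hn : ∀ m : ℕ, ‖lam‖ ^ m ≤ ‖ρ (d ^ m)‖ := by
    intro m
    have := (ρ (d ^ m)).le_opNorm v
    rw [hpow, norm_smul, norm_pow] at this
    exact le_of_mul_le_mul_right this (norm_pos_iff.2 hv)
  obtain ⟨c, hc⟩ := NormedField.exists_one_lt_norm F
  have hsh : ∀ m : ℕ, ∃ κ : F, κ ≠ 0 ∧ ‖κ • ρ (d ^ m)‖ < 1 ∧ 1 / ‖c‖ ≤ ‖κ • ρ (d ^ m)‖ := by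
    intro m
    have hne : ρ (d ^ m) ≠ 0 := by
      rw [← norm_pos_iff]; exact lt_of_lt_of_le (by positivity) (hn m)
    obtain ⟨κ, h0, h1, h2, _⟩ := rescale_to_shell hc one_pos hne
    exact ⟨κ, h0, h1, h2⟩
  choose κ hκ0 hκ1 hκ2 using hsh
  have hκ : Filter.Tendsto κ Filter.atTop (nhds 0) := by
    have hb : ∀ m, ‖κ m‖ ≤ ‖lam‖⁻¹ ^ m := by
      intro m
      have h1 := (hκ1 m).le
      rw [norm_smul] at h1
      have h2 : ‖κ m‖ * ‖lam‖ ^ m ≤ 1 :=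
        (mul_le_mul_of_nonneg_left (hn m) (norm_nonneg _)).trans h1
      rw [inv_pow, ← one_div, le_div_iff₀ (by positivity)]
      exact h2
    exact squeeze_zero_norm hb
      (tendsto_pow_atTop_nhds_zero_of_lt_one (by positivity) (inv_lt_one_of_one_lt₀ hlam))
  haveI : ProperSpace (W →L[F] W) := FiniteDimensional.proper F _
  obtain ⟨y0, _, φ, hφ, hlim⟩ := tendsto_subseq_of_bounded
    (s := Metric.closedBall (0 : W →L[F] W) 1) Metric.isBounded_closedBall
    (x := fun m => κ m • ρ (d ^ m)) (fun m => by simpa using (hκ1 m).le)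
  refine tits_dynamics ρ (tits_gen_of_irr ρ A hdom hinv hpoly irr) y0 ?_ ?_ ?_
  · refine mem_closure_of_tendsto hlim (Filter.Eventually.of_forall fun m => ?_)
    exact ⟨_, _, rfl⟩
  · have h1 : 1 / ‖c‖ ≤ ‖y0‖ :=
      ge_of_tendsto hlim.norm (Filter.Eventually.of_forall fun m => hκ2 _)
    rw [← norm_pos_iff]
    exact lt_of_lt_of_le (by positivity) h1
  · intro htop
    have h1 : Filter.Tendsto (fun m => ((κ (φ m) • ρ (d ^ (φ m)) : W →L[F] W)).det)
        Filter.atTop (nhds y0.det) :=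
      (ContinuousLinearMap.continuous_det.tendsto y0).comp hlim
    have h2 : ∀ m, ((κ (φ m) • ρ (d ^ (φ m)) : W →L[F] W)).det = κ (φ m) ^ Module.finrank F W := by
      intro m
      change LinearMap.det (κ (φ m) • ((ρ (d ^ (φ m)) : W →L[F] W) : W →ₗ[F] W)) = _
      rw [LinearMap.det_smul, hdet, mul_one]
    simp only [h2] at h1
    haveI : Nontrivial W := ⟨v, 0, hv⟩
    have h3 : Filter.Tendsto (fun m => κ (φ m) ^ Module.finrank F W) Filter.atTop (nhds 0) := by
      have := (hκ.comp hφ.tendsto_atTop).pow (Module.finrank F W)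
      rw [zero_pow Module.finrank_pos.ne'] at this
      exact this
    have h4 : LinearMap.det (y0 : W →ₗ[F] W) = 0 := tendsto_nhds_unique h1 h3
    have h5 : IsUnit (y0 : W →ₗ[F] W) := by
      rw [LinearMap.isUnit_iff_range_eq_top]; exact htop
    have := (LinearMap.isUnit_iff_isUnit_det _).1 h5
    rw [h4] at this
    exact not_isUnit_zero this
end

/-- general representation -/
theorem tits_rep {F G : Type*} [NontriviallyNormedField F] [ProperSpace F] [Group G]
    (A : Subalgebra F (G → F))
    (hdom : ∀ f ∈ A, ∀ g ∈ A, f * g = 0 → f = 0 ∨ g = 0)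
    (hinv : ∀ f ∈ A, (fun h => f h⁻¹) ∈ A)
    (d : G) (hd : d ∈ commutator G) (lam : F) (hlam : 1 < ‖lam‖) (n : ℕ) :
    ∀ (V : Type u) [AddCommGroup V] [Module F V] [FiniteDimensional F V]
    (_ : Module.finrank F V = n) (ρ : G →* (V →ₗ[F] V))
    (_ : ∀ (φ : V →ₗ[F] F) (v : V), (fun h => φ (ρ h v)) ∈ A)
    (v : V) (_ : v ≠ 0) (_ : ρ d v = lam • v),
    ∃ a : Fin 2 → G, Function.Injective (FreeGroup.lift a) := by
  induction n using Nat.strong_induction_on with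
  | _ n ih =>
  intro V _ _ _ hV ρ hpoly v hv hdv
  by_cases irr : ∀ U : Submodule F V, (∀ h, ∀ u ∈ U, ρ h u ∈ U) → U = ⊥ ∨ U = ⊤
  · let e : V ≃ₗ[F] (Fin (Module.finrank F V) → F) := (Module.finBasis F V).equivFun
    let R : (V →ₗ[F] V) ≃+* ((Fin (Module.finrank F V) → F) →L[F] (Fin (Module.finrank F V) → F)) :=
      e.conjRingEquiv.trans (Module.End.toContinuousLinearMap _).toRingEquiv
    have hR : ∀ T x, R T x = e (T (e.symm x)) := fun T x => rfl
    refine tits_irr ((R : (V →ₗ[F] V) →* _).comp ρ) A hdom hinv ?_ ?_ d hd lam hlam (e v)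
      (by simpa using hv) ?_
    · intro φ w
      exact hpoly (φ ∘ₗ (e : V →ₗ[F] _)) (e.symm w)
    · intro U hU
      rcases irr (U.comap (e : V →ₗ[F] _)) (by
        intro h u hu
        have := hU h _ hu
        change e (ρ h (e.symm (e u))) ∈ U at this
        rw [e.symm_apply_apply] at this
        exact this) with h | h
      · left
        rw [eq_bot_iff]
        intro x hx
        have : e.symm x ∈ U.comap (e : V →ₗ[F] _) := by simpa using hx
        rw [h] at this
        simpa using this
      · right
        rw [eq_top_iff]
        intro x _
        have : e.symm x ∈ U.comap (e : V →ₗ[F] _) := by rw [h]; trivial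
        simpa using this
    · change e (ρ d (e.symm (e v))) = _
      rw [e.symm_apply_apply, hdv, map_smul]
  · push Not at irr
    obtain ⟨U, hU, hbot, htop⟩ := irr
    by_cases hvU : v ∈ U
    · refine ih (Module.finrank F U) (hV ▸ Submodule.finrank_lt htop) U rfl
        { toFun := fun g => (ρ g).restrict (hU g)
          map_one' := by ext x; simp
          map_mul' := by intro x y; ext z; simp } ?_ ⟨v, hvU⟩ ?_ ?_
      · intro φ u
        obtain ⟨ψ, hψ⟩ := LinearMap.exists_extend φ
        have : (fun h => φ ((ρ h).restrict (hU h) u)) = fun h => ψ (ρ h u) := by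
          ext h; rw [← hψ]; rfl
        exact this ▸ hpoly ψ u
      · simpa using hv
      · ext; exact hdv
    · refine ih (Module.finrank F (V ⧸ U)) ?_ (V ⧸ U) rfl
        { toFun := fun g => U.mapQ U (ρ g) (hU g)
          map_one' := by ext x; simp
          map_mul' := by intro x y; ext z; simp } ?_ (U.mkQ v) ?_ ?_
      · have := Submodule.finrank_quotient_add_finrank U
        have h2 : 0 < Module.finrank F U := by
          haveI := Submodule.nontrivial_iff_ne_bot.2 hbot
          exact Module.finrank_pos
        omega
      · intro φ u
        obtain ⟨u, rfl⟩ := U.mkQ_surjective u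
        exact hpoly (φ ∘ₗ U.mkQ) u
      · simpa using hvU
      · change U.mkQ (ρ d v) = _
        rw [hdv, map_smul]


theorem tits_connected {K G : Type*} [Field K] [Group G] (A : Subalgebra K (G → K))
    [IsNoetherianRing A] (hl : ∀ f ∈ A, ∀ g, (fun x => f (g * x)) ∈ A)
    (hr : ∀ f ∈ A, ∀ g, (fun x => f (x * g)) ∈ A) :
    ∃ Δ : Subgroup G, Δ.FiniteIndex ∧ ∀ f ∈ A, ∀ g ∈ A, (∀ h ∈ Δ, f h * g h = 0) →
      (∀ h ∈ Δ, f h = 0) ∨ (∀ h ∈ Δ, g h = 0) := by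
  classical
  let τ : G → (A →+* A) := fun g =>
    { toFun := fun f => ⟨fun x => f.1 (x * g), hr f.1 f.2 g⟩
      map_one' := rfl
      map_mul' := fun _ _ => rfl
      map_zero' := rfl
      map_add' := fun _ _ => rfl }
  have τ1 : τ 1 = RingHom.id A := by
    ext f x
    change f.1 (x * 1) = f.1 x
    rw [mul_one]
  have τm : ∀ g h, τ (g * h) = (τ g).comp (τ h) := by
    intro g h
    ext f x
    change f.1 (x * (g * h)) = f.1 (x * g * h)
    rw [mul_assoc]
  have hmin : ∀ g, ∀ P ∈ minimalPrimes A, P.comap (τ g) ∈ minimalPrimes A := by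
    intro g P hP
    haveI := hP.1.1
    refine ⟨⟨Ideal.comap_isPrime _ _, bot_le⟩, ?_⟩
    rintro Q ⟨hQ, _⟩ hQP
    have h1 : Q.comap (τ g⁻¹) ≤ P := by
      intro f hf
      have := hQP hf
      rw [Ideal.mem_comap, ← RingHom.comp_apply, ← τm, mul_inv_cancel, τ1] at this
      exact this
    have h2 := hP.2 ⟨Ideal.comap_isPrime _ _, bot_le⟩ h1
    intro f hf
    have := h2 hf
    rw [Ideal.mem_comap, ← RingHom.comp_apply, ← τm, inv_mul_cancel, τ1] at this
    exact this
  let act : MulAction G (minimalPrimes A) :=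
    { smul := fun g P => ⟨P.1.comap (τ g⁻¹), hmin _ _ P.2⟩
      one_smul := by
        intro P
        apply Subtype.ext
        change P.1.comap (τ 1⁻¹) = P.1
        rw [inv_one, τ1, Ideal.comap_id]
      mul_smul := by
        intro g h P
        apply Subtype.ext
        change P.1.comap (τ (g * h)⁻¹) = (P.1.comap (τ h⁻¹)).comap (τ g⁻¹)
        rw [mul_inv_rev, τm, Ideal.comap_comap] }
  haveI : Finite (minimalPrimes A) := (minimalPrimes.finite_of_isNoetherianRing A).to_subtype
  let Δ := (MulAction.toPermHom G (minimalPrimes A)).ker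
  have hΔ : Δ.FiniteIndex := inferInstance
  have hΔP : ∀ g ∈ Δ, ∀ P ∈ minimalPrimes A, P.comap (τ g) = P := by
    intro g hg P hP
    have h1 : g⁻¹ ∈ Δ := Δ.inv_mem hg
    have h2 := congrArg (fun p : Equiv.Perm (minimalPrimes A) => (p ⟨P, hP⟩).1)
      (MonoidHom.mem_ker.1 h1)
    change P.comap (τ g⁻¹⁻¹) = P at h2
    rwa [inv_inv] at h2
  -- vanishing ideals
  let I : G → Ideal A := fun y =>
    { carrier := {f | ∀ h ∈ Δ, f.1 (y * h) = 0}
      add_mem' := by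
        intro a b ha hb h hh
        change a.1 _ + b.1 _ = 0
        rw [ha h hh, hb h hh, add_zero]
      zero_mem' := fun _ _ => rfl
      smul_mem' := by
        intro c a ha h hh
        change c.1 _ * a.1 _ = 0
        rw [ha h hh, mul_zero] }
  have hIP : ∀ y, ∃ P ∈ minimalPrimes A, P ≤ I y := by
    intro y
    let ev : A →+* K := (Pi.evalRingHom (fun _ : G => K) y).comp (A.val : A →+* (G → K))
    haveI : (RingHom.ker ev).IsPrime := RingHom.ker_isPrime ev
    obtain ⟨P, hP, hle⟩ := Ideal.exists_minimalPrimes_le (I := ⊥) (J := RingHom.ker ev) bot_le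
    refine ⟨P, hP, ?_⟩
    intro f hf h hh
    have h1 : f ∈ P.comap (τ h) := by rw [hΔP h hh P hP]; exact hf
    exact hle h1
  obtain ⟨P, hP, -⟩ := hIP 1
  haveI := hP.1.1
  haveI : Finite (G ⧸ Δ) := Subgroup.finite_quotient_of_finiteIndex
  haveI := Fintype.ofFinite (G ⧸ Δ)
  have hinf : (Finset.univ.inf fun q : G ⧸ Δ => I q.out) ≤ P := by
    intro f hf
    have : f = 0 := by
      ext x
      rw [Submodule.mem_finsetInf] at hf
      have h1 := hf (QuotientGroup.mk x) (Finset.mem_univ _)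
      obtain ⟨h, hh⟩ := QuotientGroup.mk_out_eq_mul Δ x
      have h2 := h1 h⁻¹ (Δ.inv_mem h.2)
      rw [hh] at h2
      simpa using h2
    rw [this]; exact P.zero_mem
  obtain ⟨q, -, hq⟩ := (Ideal.IsPrime.inf_le' inferInstance).1 hinf
  obtain ⟨P', hP', hle⟩ := hIP q.out
  have hIq : I q.out = P :=
    le_antisymm hq ((hP.2 hP'.1 (hle.trans hq)).trans hle)
  refine ⟨Δ, hΔ, fun f hf g hg hfg => ?_⟩
  set y := q.out
  let f' : A := ⟨fun x => f (y⁻¹ * x), hl f hf _⟩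
  let g' : A := ⟨fun x => g (y⁻¹ * x), hl g hg _⟩
  have hm : f' * g' ∈ I y := by
    intro h hh
    change f (y⁻¹ * (y * h)) * g (y⁻¹ * (y * h)) = 0
    rw [inv_mul_cancel_left]
    exact hfg h hh
  rw [hIq] at hm
  rcases hP.1.1.mem_or_mem hm with h | h
  · left
    rw [← hIq] at h
    intro x hx
    have := h x hx
    change f (y⁻¹ * (y * x)) = 0 at this
    rwa [inv_mul_cancel_left] at this
  · right
    rw [← hIq] at h
    intro x hx
    have := h x hx
    change g (y⁻¹ * (y * x)) = 0 at this
    rwa [inv_mul_cancel_left] at this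

/-- The coordinate algebra of a matrix representation. -/
def titsAlg {K G : Type*} [Field K] [Group G] {n : ℕ} (ρ : G →* Matrix (Fin n) (Fin n) K) :
    Subalgebra K (G → K) :=
  Algebra.adjoin K ((Set.range fun p : Fin n × Fin n => fun g => ρ g p.1 p.2) ∪
    (Set.range fun p : Fin n × Fin n => fun g => ρ g⁻¹ p.1 p.2))

section
variable {K G : Type*} [Field K] [Group G] {n : ℕ} (ρ : G →* Matrix (Fin n) (Fin n) K)

theorem titsAlg_mem (i j : Fin n) : (fun g => ρ g i j) ∈ titsAlg ρ :=
  Algebra.subset_adjoin (Or.inl ⟨(i, j), rfl⟩)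

theorem titsAlg_mem_inv (i j : Fin n) : (fun g => ρ g⁻¹ i j) ∈ titsAlg ρ :=
  Algebra.subset_adjoin (Or.inr ⟨(i, j), rfl⟩)

theorem titsAlg_comp (σ : G → G) (h1 : ∀ i j, (fun g => ρ (σ g) i j) ∈ titsAlg ρ)
    (h2 : ∀ i j, (fun g => ρ (σ g)⁻¹ i j) ∈ titsAlg ρ) (f : G → K) (hf : f ∈ titsAlg ρ) :
    (fun g => f (σ g)) ∈ titsAlg ρ := by
  induction hf using Algebra.adjoin_induction with
  | mem x hx =>
    rcases hx with ⟨p, rfl⟩ | ⟨p, rfl⟩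
    · exact h1 _ _
    · exact h2 _ _
  | algebraMap r => exact (titsAlg ρ).algebraMap_mem r
  | add x y _ _ hx hy => exact (titsAlg ρ).add_mem hx hy
  | mul x y _ _ hx hy => exact (titsAlg ρ).mul_mem hx hy

theorem titsAlg_inv (f : G → K) (hf : f ∈ titsAlg ρ) : (fun g => f g⁻¹) ∈ titsAlg ρ :=
  titsAlg_comp ρ (fun g => g⁻¹) (titsAlg_mem_inv ρ) (by simpa using titsAlg_mem ρ) f hf

theorem titsAlg_sum (s t : Fin n → G → K) (hs : ∀ i, s i ∈ titsAlg ρ) (ht : ∀ i, t i ∈ titsAlg ρ) :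
    (fun g => ∑ i, s i g * t i g) ∈ titsAlg ρ := by
  have : (fun g => ∑ i, s i g * t i g) = ∑ i, s i * t i := by ext g; simp
  rw [this]
  exact Subalgebra.sum_mem _ fun i _ => Subalgebra.mul_mem _ (hs i) (ht i)

theorem titsAlg_const (c : K) : (fun _ => c) ∈ titsAlg ρ := (titsAlg ρ).algebraMap_mem c

theorem titsAlg_left (f : G → K) (hf : f ∈ titsAlg ρ) (y : G) : (fun g => f (y * g)) ∈ titsAlg ρ := by
  refine titsAlg_comp ρ (fun g => y * g) ?_ ?_ f hf
  · intro i j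
    simp only [map_mul, Matrix.mul_apply]
    exact titsAlg_sum ρ _ _ (fun k => titsAlg_const ρ _) (fun k => titsAlg_mem ρ k j)
  · intro i j
    simp only [mul_inv_rev, map_mul, Matrix.mul_apply]
    exact titsAlg_sum ρ _ _ (fun k => titsAlg_mem_inv ρ _ _) (fun k => titsAlg_const ρ _)

theorem titsAlg_right (f : G → K) (hf : f ∈ titsAlg ρ) (y : G) : (fun g => f (g * y)) ∈ titsAlg ρ := by
  refine titsAlg_comp ρ (fun g => g * y) ?_ ?_ f hf
  · intro i j
    simp only [map_mul, Matrix.mul_apply]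
    exact titsAlg_sum ρ _ _ (fun k => titsAlg_mem ρ _ _) (fun k => titsAlg_const ρ _)
  · intro i j
    simp only [mul_inv_rev, map_mul, Matrix.mul_apply]
    exact titsAlg_sum ρ _ _ (fun k => titsAlg_const ρ _) (fun k => titsAlg_mem_inv ρ _ _)

theorem titsAlg_restrict (Δ : Subgroup G) (f : Δ → K) (hf : f ∈ titsAlg (ρ.comp Δ.subtype)) :
    ∃ f' ∈ titsAlg ρ, ∀ h : Δ, f h = f' h := by
  induction hf using Algebra.adjoin_induction with
  | mem x hx =>
    rcases hx with ⟨p, rfl⟩ | ⟨p, rfl⟩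
    · exact ⟨_, titsAlg_mem ρ p.1 p.2, fun h => rfl⟩
    · exact ⟨_, titsAlg_mem_inv ρ p.1 p.2, fun h => rfl⟩
  | algebraMap r => exact ⟨_, (titsAlg ρ).algebraMap_mem r, fun h => rfl⟩
  | add x y _ _ hx hy =>
    obtain ⟨x', hx', hx⟩ := hx
    obtain ⟨y', hy', hy⟩ := hy
    exact ⟨_, (titsAlg ρ).add_mem hx' hy', fun h => by simp [hx, hy]⟩
  | mul x y _ _ hx hy =>
    obtain ⟨x', hx', hx⟩ := hx
    obtain ⟨y', hy', hy⟩ := hy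
    exact ⟨_, (titsAlg ρ).mul_mem hx' hy', fun h => by simp [hx, hy]⟩

theorem tits_connected_rep : ∃ Δ : Subgroup G, Δ.FiniteIndex ∧
    ∀ f ∈ titsAlg (ρ.comp Δ.subtype), ∀ g ∈ titsAlg (ρ.comp Δ.subtype), f * g = 0 →
      f = 0 ∨ g = 0 := by
  have hn : IsNoetherianRing (titsAlg ρ) := by
    have : (titsAlg ρ).FG := by
      refine (Subalgebra.fg_def).2 ⟨_, ?_, rfl⟩
      exact (Set.finite_range _).union (Set.finite_range _)
    haveI := (titsAlg ρ).fg_iff_finiteType.1 this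
    exact Algebra.FiniteType.isNoetherianRing K _
  obtain ⟨Δ, h1, h2⟩ := tits_connected (titsAlg ρ) (titsAlg_left ρ) (titsAlg_right ρ)
  refine ⟨Δ, h1, fun f hf g hg hfg => ?_⟩
  obtain ⟨f', hf', hff⟩ := titsAlg_restrict ρ Δ f hf
  obtain ⟨g', hg', hgg⟩ := titsAlg_restrict ρ Δ g hg
  rcases h2 f' hf' g' hg' (fun h hh => by
    rw [← hff ⟨h, hh⟩, ← hgg ⟨h, hh⟩]; exact congrFun hfg ⟨h, hh⟩) with h | h
  · left; ext x; rw [hff]; exact h x x.2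
  · right; ext x; rw [hgg]; exact h x x.2
end

/-- field transfer -/
theorem titsAlg_transfer {K0 K F G : Type*} [Field K0] [Field K] [Field F] [Algebra K0 K]
    [Algebra K0 F] [Group G] {n : ℕ} (ρ : G →* Matrix (Fin n) (Fin n) K0)
    (ρK : G →* Matrix (Fin n) (Fin n) K) (ρF : G →* Matrix (Fin n) (Fin n) F)
    (hK : ∀ g i j, ρK g i j = algebraMap K0 K (ρ g i j))
    (hF : ∀ g i j, ρF g i j = algebraMap K0 F (ρ g i j))
    (hdom : ∀ f ∈ titsAlg ρK, ∀ g ∈ titsAlg ρK, f * g = 0 → f = 0 ∨ g = 0) :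
    ∀ f ∈ titsAlg ρF, ∀ g ∈ titsAlg ρF, f * g = 0 → f = 0 ∨ g = 0 := by
  -- K0-linear functionals map the F algebra into the K algebra
  have mon : ∀ f ∈ Submonoid.closure ((Set.range fun p : Fin n × Fin n => fun g => ρF g p.1 p.2) ∪
    (Set.range fun p : Fin n × Fin n => fun g => ρF g⁻¹ p.1 p.2)), ∃ s : G → K0,
      (∀ g, f g = algebraMap K0 F (s g)) ∧ (fun g => algebraMap K0 K (s g)) ∈ titsAlg ρK := by
    intro f hf
    induction hf using Submonoid.closure_induction with
    | mem x hx =>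
      rcases hx with ⟨p, rfl⟩ | ⟨p, rfl⟩
      · refine ⟨fun g => ρ g p.1 p.2, fun g => hF _ _ _, ?_⟩
        simp only [← hK]; exact titsAlg_mem ρK _ _
      · refine ⟨fun g => ρ g⁻¹ p.1 p.2, fun g => hF _ _ _, ?_⟩
        simp only [← hK]; exact titsAlg_mem_inv ρK _ _
    | one => exact ⟨fun _ => 1, by simp, by simpa using titsAlg_const ρK 1⟩
    | mul x y _ _ hx hy =>
      obtain ⟨s, hs, hs'⟩ := hx
      obtain ⟨t, ht, ht'⟩ := hy
      refine ⟨s * t, by simp [hs, ht], ?_⟩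
      simp only [Pi.mul_apply, map_mul]
      exact (titsAlg ρK).mul_mem hs' ht'
  have lin : ∀ f ∈ titsAlg ρF, ∀ l : F →ₗ[K0] K, (fun g => l (f g)) ∈ titsAlg ρK := by
    intro f hf
    unfold titsAlg at hf
    rw [← Subalgebra.mem_toSubmodule, Algebra.adjoin_eq_span] at hf
    induction hf using Submodule.span_induction with
    | mem x hx =>
      intro l
      obtain ⟨s, hs, hs'⟩ := mon x hx
      have : (fun g => l (x g)) = fun g => l 1 * algebraMap K0 K (s g) := by
        ext g
        rw [hs, Algebra.algebraMap_eq_smul_one, map_smul, Algebra.smul_def, mul_comm]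
      rw [this]
      exact (titsAlg ρK).mul_mem (titsAlg_const ρK (l 1)) hs'
    | zero => intro l; simpa using titsAlg_const ρK 0
    | add x y _ _ hx hy =>
      intro l
      simp only [Pi.add_apply, map_add]
      exact (titsAlg ρK).add_mem (hx l) (hy l)
    | smul c x _ hx =>
      intro l
      exact hx (l ∘ₗ LinearMap.mulLeft K0 c)
  intro f hf g hg hfg
  by_contra! hcon
  obtain ⟨a, ha⟩ := Function.ne_iff.1 hcon.1
  obtain ⟨b, hb⟩ := Function.ne_iff.1 hcon.2
  have ex : ∀ x : F, x ≠ 0 → ∃ l : F →ₗ[K0] K, l x ≠ 0 := by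
    intro x hx
    obtain ⟨φ, hφ⟩ : ∃ φ : Module.Dual K0 F, φ x ≠ 0 := by
      by_contra! h; exact hx ((Module.forall_dual_apply_eq_zero_iff K0 _).1 h)
    exact ⟨Algebra.linearMap K0 K ∘ₗ φ, by simpa using hφ⟩
  obtain ⟨l1, h1⟩ := ex _ ha
  obtain ⟨l2, h2⟩ := ex _ hb
  rcases hdom _ (lin f hf l1) _ (lin g hg l2) (by
    ext x
    have := congrFun hfg x
    simp only [Pi.mul_apply, Pi.zero_apply, mul_eq_zero] at this ⊢
    rcases this with h | h
    · left; rw [h, map_zero]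
    · right; rw [h, map_zero]) with h | h
  · exact h1 (congrFun h a)
  · exact h2 (congrFun h b)


theorem tits_jacobson_int : IsJacobsonRing ℤ := by
  rw [isJacobsonRing_iff_prime_eq]
  intro P hP
  by_cases h : P = ⊥
  · subst h
    rw [eq_bot_iff]
    intro x hx
    have h1 := (Ideal.mem_jacobson_bot.1 hx) x
    rw [Int.isUnit_iff] at h1
    rw [Ideal.mem_bot]
    rcases h1 with h1 | h1
    · have : x * x = 0 := by linarith
      simpa using this
    · nlinarith [mul_self_nonneg x]
  · haveI := hP.isMaximal h
    exact Ideal.jacobson_eq_self_of_isMaximal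

theorem tits_finite_residue {K : Type*} [Field K] (T : Set K) (hT : T.Finite)
    (m : Ideal (Algebra.adjoin ℤ T)) [m.IsMaximal] :
    Finite (Algebra.adjoin ℤ T ⧸ m) := by
  letI := Ideal.Quotient.field m
  have h0 : (Algebra.adjoin ℤ T).FG := Subalgebra.fg_def.2 ⟨T, hT, rfl⟩
  haveI := (Algebra.adjoin ℤ T).fg_iff_finiteType.1 h0
  haveI : Algebra.FiniteType ℤ (Algebra.adjoin ℤ T ⧸ m) :=
    Algebra.FiniteType.of_surjective (Ideal.Quotient.mkₐ ℤ m) (Ideal.Quotient.mkₐ_surjective ℤ m)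
  haveI : Module.Finite ℤ (Algebra.adjoin ℤ T ⧸ m) :=
    haveI := tits_jacobson_int
    finite_of_finite_type_of_isJacobsonRing ℤ _
  apply Module.finite_of_fg_torsion
  by_cases hinj : Function.Injective (algebraMap ℤ (Algebra.adjoin ℤ T ⧸ m))
  · exfalso
    haveI : Algebra.IsIntegral ℤ (Algebra.adjoin ℤ T ⧸ m) := Algebra.IsIntegral.of_finite ℤ _
    exact Int.not_isField (isField_of_isIntegral_of_isField hinj (Field.toIsField _))
  · rw [injective_iff_map_eq_zero] at hinj
    push Not at hinj
    obtain ⟨a, ha, ha0⟩ := hinj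
    intro x
    refine ⟨⟨a, mem_nonZeroDivisors_of_ne_zero ha0⟩, ?_⟩
    change a • x = 0
    rw [Algebra.smul_def, ha, zero_mul]

/-- lift a matrix representation to a subring -/
def titsLift {K G : Type*} [Field K] [Group G] {n : ℕ} (ρ : G →* Matrix (Fin n) (Fin n) K)
    {S : Type*} [SetLike S K] [SubringClass S K] (R : S) (h : ∀ g i j, ρ g i j ∈ R) :
    G →* Matrix (Fin n) (Fin n) R where
  toFun g := Matrix.of fun i j => ⟨ρ g i j, h g i j⟩
  map_one' := by
    ext i j
    simp only [map_one, Matrix.of_apply, Matrix.one_apply]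
    split_ifs <;> simp
  map_mul' x y := by
    ext i j
    simp [Matrix.mul_apply]

theorem tits_congruence_step {K G : Type*} [Field K] [Group G] {n : ℕ}
    (ρ : G →* Matrix (Fin n) (Fin n) K) (T : Set K) (hT : T.Finite)
    (hρ : ∀ g i j, ρ g i j ∈ Algebra.adjoin ℤ T) :
    ∃ p : ℕ, p.Prime ∧ (∀ x ∈ Algebra.adjoin ℤ T, (p : K) * x ≠ 1) ∧
      ∃ Δ : Subgroup G, Δ.FiniteIndex ∧ ∀ γ ∈ Δ, ∀ (ζ : K) (v : Fin n → K), v ≠ 0 →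
        (ρ γ).mulVec v = ζ • v → ∀ l : ℕ, l.Prime → ζ ^ l = 1 → ζ ≠ 1 → l = p := by
  obtain ⟨m, hm⟩ := Ideal.exists_maximal (Algebra.adjoin ℤ T)
  haveI := tits_finite_residue T hT m
  letI := Ideal.Quotient.field m
  obtain ⟨p, hp⟩ := CharP.exists (Algebra.adjoin ℤ T ⧸ m)
  have hpp : p.Prime := (CharP.char_is_prime_or_zero (Algebra.adjoin ℤ T ⧸ m) p).resolve_right
    (CharP.char_ne_zero_of_finite (Algebra.adjoin ℤ T ⧸ m) p)
  have hpm : (p : Algebra.adjoin ℤ T) ∈ m := by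
    rw [← Ideal.Quotient.eq_zero_iff_mem, map_natCast]
    exact CharP.cast_eq_zero _ p
  refine ⟨p, hpp, ?_, ?_⟩
  · intro x hx h
    apply hm.ne_top
    rw [Ideal.eq_top_iff_one]
    have : (1 : Algebra.adjoin ℤ T) = p * ⟨x, hx⟩ := by
      apply Subtype.ext; simp [h]
    rw [this]
    exact m.mul_mem_right _ hpm
  · let ρR := titsLift ρ (Algebra.adjoin ℤ T) hρ
    let π : Algebra.adjoin ℤ T →+* Algebra.adjoin ℤ T ⧸ m := Ideal.Quotient.mk m
    let ρm : G →* Matrix (Fin n) (Fin n) (Algebra.adjoin ℤ T ⧸ m) :=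
      (RingHom.toMonoidHom π.mapMatrix).comp ρR
    refine ⟨ρm.toHomUnits.ker, inferInstance, ?_⟩
    intro γ hγ ζ v hv hγv l hl hζl hζ1
    have h1 : π.mapMatrix (ρR γ) = 1 := congrArg Units.val (MonoidHom.mem_ker.1 hγ)
    have hroot : ((ρ γ).charpoly).eval ζ = 0 := by
      rw [Matrix.eval_charpoly, ← Matrix.exists_mulVec_eq_zero_iff]
      refine ⟨v, hv, ?_⟩
      rw [Matrix.sub_mulVec, hγv, sub_eq_zero]
      ext i
      simp [Matrix.scalar_apply, Matrix.mulVec_diagonal]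
    let S := integralClosure (Algebra.adjoin ℤ T) K
    obtain ⟨Q, hQ, hQm⟩ := Ideal.exists_ideal_over_maximal_of_isIntegral (S := S) m (by
      intro x hx
      have hx0 : algebraMap (Algebra.adjoin ℤ T) S x = 0 := hx
      have : x = 0 := by
        apply Subtype.ext
        exact congrArg (algebraMap S K) hx0
      rw [this]; exact m.zero_mem)
    have hζS : ζ ∈ S := by
      refine ⟨Polynomial.X ^ l - 1, Polynomial.monic_X_pow_sub_C 1 hl.ne_zero, ?_⟩
      simp [hζl]
    let z : S := ⟨ζ, hζS⟩
    let q : S →+* S ⧸ Q := Ideal.Quotient.mk Q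
    letI := Ideal.Quotient.field Q
    have hz1 : q z = 1 := by
      have h2 : Polynomial.eval₂ (algebraMap (Algebra.adjoin ℤ T) S) z (ρR γ).charpoly = 0 := by
        apply Subtype.ext
        change algebraMap S K _ = algebraMap S K 0
        have h3 : (ρR γ).map ((algebraMap S K).comp (algebraMap (Algebra.adjoin ℤ T) S)) = ρ γ := by
          ext i j; rfl
        rw [map_zero, Polynomial.hom_eval₂, ← hroot, ← Polynomial.eval_map, ← Matrix.charpoly_map,
          h3]
        rfl
      let r : (Algebra.adjoin ℤ T ⧸ m) →+* S ⧸ Q :=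
        Ideal.Quotient.lift m (q.comp (algebraMap (Algebra.adjoin ℤ T) S)) (by
          intro a ha
          rw [← hQm] at ha
          exact Ideal.Quotient.eq_zero_iff_mem.2 ha)
      have hr : r.comp π = q.comp (algebraMap (Algebra.adjoin ℤ T) S) := by
        ext x; rfl
      have h3 := congrArg q h2
      rw [map_zero, Polynomial.hom_eval₂, ← hr, ← Polynomial.eval_map, ← Matrix.charpoly_map] at h3
      have h4 : (ρR γ).map (r.comp π) = 1 := by
        have : (ρR γ).map (r.comp π) = r.mapMatrix (π.mapMatrix (ρR γ)) := by
          ext i j; rfl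
        rw [this, h1, map_one]
      rw [h4, Matrix.charpoly_one] at h3
      simp only [Polynomial.eval_pow, Polynomial.eval_sub, Polynomial.eval_X,
        Polynomial.eval_one] at h3
      exact sub_eq_zero.1 (eq_zero_of_pow_eq_zero h3)
    have hsum : ∑ i ∈ Finset.range l, z ^ i = 0 := by
      apply Subtype.ext
      have h5 : (∑ i ∈ Finset.range l, ζ ^ i) * (ζ - 1) = 0 := by
        rw [geom_sum_mul, hζl, sub_self]
      have h6 := (mul_eq_zero.1 h5).resolve_right (sub_ne_zero.2 hζ1)
      simpa [z] using h6
    have hl0 : (l : S ⧸ Q) = 0 := by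
      have := congrArg q hsum
      simpa [hz1] using this
    have hp0 : (p : S ⧸ Q) = 0 := by
      have h7 : algebraMap (Algebra.adjoin ℤ T) S p ∈ Q := by
        rw [← hQm] at hpm; exact hpm
      rw [map_natCast] at h7
      have := Ideal.Quotient.eq_zero_iff_mem.2 h7
      simpa using this
    by_contra hne
    have hco := (Nat.coprime_primes hl hpp).2 hne
    have := Nat.isCoprime_iff_coprime.2 hco
    obtain ⟨a, b, hab⟩ := this
    have h8 := congrArg (Int.cast : ℤ → S ⧸ Q) hab
    push_cast at h8
    rw [hl0, hp0] at h8
    simp at h8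

theorem tits_entries {K G : Type*} [Field K] [Group G] [Group.FG G] {n : ℕ}
    (ρ : G →* Matrix (Fin n) (Fin n) K) :
    ∃ T : Set K, T.Finite ∧ ∀ g i j, ρ g i j ∈ Algebra.adjoin ℤ T := by
  obtain ⟨S, hS⟩ := Group.FG.out (G := G)
  let T : Set K := (⋃ s ∈ S, ⋃ i, ⋃ j, {ρ s i j}) ∪ (⋃ s ∈ S, ⋃ i, ⋃ j, {ρ s⁻¹ i j})
  refine ⟨T, ?_, ?_⟩
  · refine Set.Finite.union ?_ ?_ <;>
    exact Set.Finite.biUnion S.finite_toSet fun s _ => Set.finite_iUnion fun i =>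
      Set.finite_iUnion fun j => Set.finite_singleton _
  · intro g
    have hg : g ∈ Subgroup.closure (S : Set G) := by rw [hS]; trivial
    suffices h : (∀ i j, ρ g i j ∈ Algebra.adjoin ℤ T) ∧ (∀ i j, ρ g⁻¹ i j ∈ Algebra.adjoin ℤ T) from h.1
    induction hg using Subgroup.closure_induction with
    | mem x hx =>
      constructor
      · intro i j
        apply Algebra.subset_adjoin
        left
        simp only [Set.mem_iUnion]
        exact ⟨x, hx, i, j, rfl⟩
      · intro i j
        apply Algebra.subset_adjoin
        right
        simp only [Set.mem_iUnion]
        exact ⟨x, hx, i, j, rfl⟩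
    | one =>
      simp only [inv_one, map_one, Matrix.one_apply, and_self]
      intro i j
      split_ifs
      · exact Subalgebra.one_mem _
      · exact Subalgebra.zero_mem _
    | mul x y _ _ hx hy =>
      simp only [mul_inv_rev, map_mul, Matrix.mul_apply]
      exact ⟨fun i j => Subalgebra.sum_mem _ fun k _ => Subalgebra.mul_mem _ (hx.1 _ _) (hy.1 _ _),
        fun i j => Subalgebra.sum_mem _ fun k _ => Subalgebra.mul_mem _ (hy.2 _ _) (hx.2 _ _)⟩
    | inv x _ hx => rw [inv_inv]; exact hx.symm

theorem tits_congruence {K G : Type*} [Field K] [Group G] [Group.FG G] {n : ℕ}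
    (ρ : G →* Matrix (Fin n) (Fin n) K) :
    ∃ Δ : Subgroup G, Δ.FiniteIndex ∧ ∀ γ ∈ Δ, ∀ (ζ : K) (v : Fin n → K), v ≠ 0 →
        (ρ γ).mulVec v = ζ • v → ∀ m : ℕ, 0 < m → ζ ^ m = 1 → ζ = 1 := by
  obtain ⟨T, hT, hρ⟩ := tits_entries ρ
  have prime : ∃ Δ : Subgroup G, Δ.FiniteIndex ∧ ∀ γ ∈ Δ, ∀ (ζ : K) (v : Fin n → K), v ≠ 0 →
        (ρ γ).mulVec v = ζ • v → ∀ l : ℕ, l.Prime → ζ ^ l = 1 → ζ = 1 := by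
    obtain ⟨p, hp, hpx, Δ, hΔ, h⟩ := tits_congruence_step ρ T hT hρ
    by_cases hp0 : (p : K) = 0
    · refine ⟨Δ, hΔ, fun γ hγ ζ v hv hζ l hl hζl => ?_⟩
      by_contra hne
      have := h γ hγ ζ v hv hζ l hl hζl hne
      subst this
      haveI : Fact l.Prime := ⟨hl⟩
      haveI : CharP K l := (CharP.charP_iff_prime_eq_zero hl).2 hp0
      have h1 : (ζ - 1) ^ l = 0 := by rw [sub_pow_char, hζl, one_pow, sub_self]
      exact hne (sub_eq_zero.1 (pow_eq_zero_iff hl.ne_zero |>.1 h1))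
    · obtain ⟨p', hp', hpx', Δ', hΔ', h'⟩ := tits_congruence_step ρ (insert (p : K)⁻¹ T)
        (hT.insert _) (fun g i j => Algebra.adjoin_mono (Set.subset_insert _ _) (hρ g i j))
      have hne' : p ≠ p' := by
        rintro rfl
        exact hpx' _ (Algebra.subset_adjoin (Set.mem_insert _ _)) (mul_inv_cancel₀ hp0)
      refine ⟨Δ ⊓ Δ', inferInstance, fun γ hγ ζ v hv hζ l hl hζl => ?_⟩
      by_contra hne
      exact hne' ((h γ hγ.1 ζ v hv hζ l hl hζl hne).symm.trans
        (h' γ hγ.2 ζ v hv hζ l hl hζl hne))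
  obtain ⟨Δ, hΔ, h⟩ := prime
  refine ⟨Δ, hΔ, fun γ hγ ζ v hv hζ m hm hζm => ?_⟩
  by_contra hne
  have h1 : orderOf ζ ≠ 1 := by rwa [Ne, orderOf_eq_one_iff]
  have h0 : 0 < orderOf ζ := orderOf_pos_iff.2 (isOfFinOrder_iff_pow_eq_one.2 ⟨m, hm, hζm⟩)
  obtain ⟨l, hl, j, hj⟩ := Nat.exists_prime_and_dvd h1
  have hpow : ∀ j : ℕ, (ρ (γ ^ j)).mulVec v = ζ ^ j • v := by
    intro j
    induction j with
    | zero => simp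
    | succ j ih =>
      rw [pow_succ, map_mul, ← Matrix.mulVec_mulVec, hζ, Matrix.mulVec_smul, ih, smul_smul,
        pow_succ, mul_comm]
  have h2 := h (γ ^ j) (Δ.pow_mem hγ j) (ζ ^ j) v hv (hpow j) l hl (by
    rw [← pow_mul, mul_comm, ← hj, pow_orderOf_eq_one])
  have h3 := orderOf_dvd_of_pow_eq_one h2
  have hj0 : 0 < j := by
    rcases Nat.eq_zero_or_pos j with rfl | h
    · omega
    · exact h
  have h4 := Nat.le_of_dvd hj0 h3
  have := hl.two_le
  nlinarith


section
variable {K G : Type*} [Field K] [Group G]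

theorem tits_burnside [IsAlgClosed K] {W : Type*} [AddCommGroup W] [Module K W]
    [FiniteDimensional K W] [Nontrivial W] (ρ : G →* Module.End K W)
    (irr : ∀ U : Submodule K W, (∀ h, ∀ u ∈ U, ρ h u ∈ U) → U = ⊥ ∨ U = ⊤) (T : Module.End K W) :
    T ∈ Submodule.span K (Set.range ρ) := by
  let A : Subalgebra K (Module.End K W) := Algebra.adjoin K (Set.range ρ)
  have hA : Subalgebra.toSubmodule A = Submodule.span K (Set.range ρ) := by
    have : Set.range ρ = (MonoidHom.mrange ρ : Set (Module.End K W)) := rfl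
    rw [Algebra.adjoin_eq_span, this, Submonoid.closure_eq]
  rw [← hA, Subalgebra.mem_toSubmodule]
  haveI : IsSimpleModule A W := by
    rw [isSimpleModule_iff]
    refine { exists_pair_ne := ⟨⊥, ⊤, bot_ne_top⟩, eq_bot_or_eq_top := fun U => ?_ }
    rcases irr (U.restrictScalars K) (by
      intro h u hu
      exact U.smul_mem (⟨ρ h, Algebra.subset_adjoin ⟨h, rfl⟩⟩ : A) hu) with h | h
    · left; exact (Submodule.restrictScalars_eq_bot_iff K A W).1 h
    · right; exact (Submodule.restrictScalars_eq_top_iff K A W).1 h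
  have hs := (IsSimpleModule.algebraMap_end_bijective_of_isAlgClosed (A := A) (V := W) K).2
  let f : Module.End (Module.End A W) W :=
    { toFun := T
      map_add' := map_add T
      map_smul' := by
        intro e w
        obtain ⟨c, rfl⟩ := hs e
        change T (c • w) = c • T w
        exact map_smul T c w }
  classical
  let b := Module.finBasis K W
  obtain ⟨r, hr⟩ := jacobson_density f (Finset.univ.image b)
  have : T = r.1 := by
    refine b.ext fun i => ?_
    exact hr (b i) (Finset.mem_image_of_mem _ (Finset.mem_univ _))
  rw [this]; exact r.2

theorem tits_irr_unipotent [IsAlgClosed K] {W : Type*} [AddCommGroup W] [Module K W]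
    [FiniteDimensional K W] [Nontrivial W] (ρ : G →* Module.End K W)
    (irr : ∀ U : Submodule K W, (∀ h, ∀ u ∈ U, ρ h u ∈ U) → U = ⊥ ∨ U = ⊤)
    (hN : ∀ g, IsNilpotent (ρ g - 1)) (g : G) : ρ g = 1 := by
  have htr : ∀ h, LinearMap.trace K W (ρ h) = LinearMap.trace K W 1 := by
    intro h
    have := (LinearMap.isNilpotent_trace_of_isNilpotent (hN h)).eq_zero
    rw [map_sub, sub_eq_zero] at this
    exact this
  have h0 : ∀ T ∈ Submodule.span K (Set.range ρ), LinearMap.trace K W ((ρ g - 1) * T) = 0 := by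
    intro T hT
    induction hT using Submodule.span_induction with
    | mem x hx =>
      obtain ⟨h, rfl⟩ := hx
      rw [sub_mul, one_mul, ← map_mul, map_sub, htr, htr, sub_self]
    | zero => simp
    | add x y _ _ hx hy => rw [mul_add, map_add, hx, hy, add_zero]
    | smul c x _ hx => rw [mul_smul_comm, map_smul, hx, smul_zero]
  rw [← sub_eq_zero]
  ext v
  rw [LinearMap.zero_apply, ← Module.forall_dual_apply_eq_zero_iff K]
  intro φ
  have h1 := h0 (dualTensorHom K W W (φ ⊗ₜ v)) (tits_burnside ρ irr _)
  have h2 : (ρ g - 1) * dualTensorHom K W W (φ ⊗ₜ v) = dualTensorHom K W W (φ ⊗ₜ ((ρ g - 1) v)) := by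
    ext w
    simp [dualTensorHom_apply]
  rw [h2, LinearMap.trace_eq_contract_apply, contractLeft_apply] at h1
  exact h1

theorem tits_pow_intertwine {U V : Type*} [AddCommGroup U] [Module K U] [AddCommGroup V] [Module K V]
    (i : U →ₗ[K] V) (e : Module.End K U) (f : Module.End K V) (h : ∀ u, i (e u) = f (i u)) (k : ℕ) :
    ∀ u, i ((e ^ k) u) = (f ^ k) (i u) := by
  induction k with
  | zero => intro u; rfl
  | succ k ih =>
    intro u
    rw [pow_succ, pow_succ, Module.End.mul_apply, Module.End.mul_apply, ih, h]

theorem tits_fixed [IsAlgClosed K] (n : ℕ) : ∀ (V : Type u) [AddCommGroup V] [Module K V]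
    [FiniteDimensional K V] [Nontrivial V] (_ : Module.finrank K V = n) (ρ : G →* Module.End K V)
    (_ : ∀ g, IsNilpotent (ρ g - 1)), ∃ v : V, v ≠ 0 ∧ ∀ g, ρ g v = v := by
  induction n using Nat.strong_induction_on with
  | _ n ih =>
  intro V _ _ _ _ hV ρ hN
  by_cases irr : ∀ U : Submodule K V, (∀ h, ∀ u ∈ U, ρ h u ∈ U) → U = ⊥ ∨ U = ⊤
  · obtain ⟨v, hv⟩ := exists_ne (0 : V)
    exact ⟨v, hv, fun g => by rw [tits_irr_unipotent ρ irr hN g]; rfl⟩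
  · push Not at irr
    obtain ⟨U, hU, hbot, htop⟩ := irr
    haveI := Submodule.nontrivial_iff_ne_bot.2 hbot
    obtain ⟨v, hv, hfix⟩ := ih (Module.finrank K U) (hV ▸ Submodule.finrank_lt htop) U rfl
        { toFun := fun g => (ρ g).restrict (hU g)
          map_one' := by ext x; simp
          map_mul' := by intro x y; ext z; simp } (by
        intro g
        obtain ⟨k, hk⟩ := hN g
        refine ⟨k, ?_⟩
        ext u
        have := tits_pow_intertwine U.subtype ((ρ g).restrict (hU g) - 1) (ρ g - 1)
          (fun u => rfl) k u
        rw [hk] at this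
        exact this)
    refine ⟨v, by simpa using hv, fun g => ?_⟩
    exact congrArg Subtype.val (hfix g)

theorem tits_kolchin [IsAlgClosed K] (n : ℕ) : ∀ (V : Type u) [AddCommGroup V] [Module K V]
    [FiniteDimensional K V] (_ : Module.finrank K V = n) (ρ : G →* Module.End K V)
    (_ : ∀ g, IsNilpotent (ρ g - 1)), ∃ m, derivedSeries G m ≤ ρ.ker := by
  induction n using Nat.strong_induction_on with
  | _ n ih =>
  intro V _ _ _ hV ρ hN
  rcases subsingleton_or_nontrivial V with hs | hnt
  · refine ⟨0, fun g _ => ?_⟩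
    rw [MonoidHom.mem_ker]
    ext v
    exact Subsingleton.elim _ _
  · obtain ⟨v, hv, hfix⟩ := tits_fixed n V hV ρ hN
    let U : Submodule K V :=
      { carrier := {v | ∀ g, ρ g v = v}
        add_mem' := by intro a b ha hb g; rw [map_add, ha, hb]
        zero_mem' := by intro g; simp
        smul_mem' := by intro c a ha g; rw [map_smul, ha] }
    have hU : ∀ h, ∀ u ∈ U, ρ h u ∈ U := by
      intro h u hu
      rw [hu h]; exact hu
    have hbot : U ≠ ⊥ := by
      intro h
      have : v ∈ U := hfix
      rw [h] at this
      exact hv (by simpa using this)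
    let ρ' : G →* Module.End K (V ⧸ U) :=
        { toFun := fun g => U.mapQ U (ρ g) (hU g)
          map_one' := by ext x; simp
          map_mul' := by intro x y; ext z; simp }
    obtain ⟨m, hm⟩ := ih (Module.finrank K (V ⧸ U)) (by
        have := Submodule.finrank_quotient_add_finrank U
        have h2 : 0 < Module.finrank K U := by
          haveI := Submodule.nontrivial_iff_ne_bot.2 hbot
          exact Module.finrank_pos
        omega) (V ⧸ U) rfl ρ' (by
        intro g
        obtain ⟨k, hk⟩ := hN g
        refine ⟨k, ?_⟩
        ext u
        have := tits_pow_intertwine U.mkQ (ρ g - 1) (ρ' g - 1) (fun u => rfl) k u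
        rw [hk] at this
        exact this.symm)
    have hmem : ∀ g ∈ derivedSeries G m, ∀ w, ρ g w - w ∈ U := by
      intro g hg w
      have h1 : ρ' g = 1 := hm hg
      have h2 : ρ' g (U.mkQ w) = U.mkQ w := by rw [h1]; rfl
      exact (Submodule.Quotient.eq U).1 h2
    have hcomm : ∀ a ∈ derivedSeries G m, ∀ b ∈ derivedSeries G m, ρ (a * b) = ρ (b * a) := by
      have hadd : ∀ a ∈ derivedSeries G m, ∀ b ∈ derivedSeries G m, ∀ w,
          ρ (a * b) w = ρ a w + ρ b w - w := by
        intro a ha b hb w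
        have h1 := hmem b hb w a
        rw [map_sub] at h1
        rw [map_mul, Module.End.mul_apply, sub_eq_iff_eq_add.1 h1]
        abel
      intro a ha b hb
      ext w
      rw [hadd a ha b hb, hadd b hb a ha, add_comm]
    refine ⟨m + 1, ?_⟩
    rw [derivedSeries_succ, Subgroup.commutator_le]
    intro a ha b hb
    rw [MonoidHom.mem_ker, commutatorElement_def]
    have h1 := hcomm a ha b hb
    calc ρ (a * b * a⁻¹ * b⁻¹) = ρ (a * b) * ρ (a⁻¹ * b⁻¹) := by rw [← map_mul, mul_assoc (a * b)]
      _ = ρ (b * a) * ρ (a⁻¹ * b⁻¹) := by rw [h1]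
      _ = 1 := by rw [← map_mul]; simp
end

/-- If no element of the commutator subgroup has an eigenvalue different from one, then solvable. -/
theorem tits_solvable {K G : Type*} [Field K] [IsAlgClosed K] [Group G] {n : ℕ}
    (ρ : G →* Matrix (Fin n) (Fin n) K) (hρ : Function.Injective ρ)
    (h : ∀ d ∈ commutator G, ∀ (z : K) (v : Fin n → K), v ≠ 0 →
      (ρ d).mulVec v = z • v → z = 1) : Group.IsSolvable G := by
  let D := commutator G
  let r : D →* Module.End K (Fin n → K) :=
    (RingHom.toMonoidHom (Matrix.toLinAlgEquiv' : Matrix (Fin n) (Fin n) K ≃ₐ[K] _).toRingHom).comp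
      (ρ.comp D.subtype)
  have hr : ∀ g v, r g v = (ρ g).mulVec v := fun g v => by
    simp [r, Matrix.toLinAlgEquiv'_apply]
  have hN : ∀ g, IsNilpotent (r g - 1) := by
    intro g
    have h1 : LinearMap.charpoly (r g) = (Polynomial.X - Polynomial.C 1) ^ (LinearMap.charpoly (r g)).natDegree := by
      have hs := IsAlgClosed.splits (LinearMap.charpoly (r g))
      have hroots : (LinearMap.charpoly (r g)).roots
          = Multiset.replicate (LinearMap.charpoly (r g)).natDegree 1 := by
        rw [Multiset.eq_replicate]
        refine ⟨hs.natDegree_eq_card_roots.symm, fun z hz => ?_⟩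
        have hz' := Polynomial.isRoot_of_mem_roots hz
        have hev := (Module.End.hasEigenvalue_iff_isRoot_charpoly _ _).2 hz'
        obtain ⟨v, hv⟩ := hev.exists_hasEigenvector
        exact h g g.2 z v hv.2 (by rw [← hr]; exact hv.apply_eq_smul)
      have h2 := hs.eq_prod_roots_of_monic (LinearMap.charpoly_monic _)
      rw [hroots] at h2
      simpa using h2
    refine ⟨(LinearMap.charpoly (r g)).natDegree, ?_⟩
    have h3 := LinearMap.aeval_self_charpoly (r g)
    rw [h1] at h3
    simpa using h3
  obtain ⟨m, hm⟩ := tits_kolchin _ (Fin n → K) rfl r hN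
  have hinj : r.ker = ⊥ := by
    rw [MonoidHom.ker_eq_bot_iff]
    intro a b hab
    apply Subtype.ext
    apply hρ
    exact Matrix.toLinAlgEquiv'.injective hab
  rw [hinj] at hm
  haveI hD : Group.IsSolvable D := ⟨⟨m, le_bot_iff.1 hm⟩⟩
  exact Group.isSolvable_of_ker_le_range D.subtype (Abelianization.of : G →* Abelianization G)
    (by rw [Abelianization.ker_of, Subgroup.range_subtype])


theorem tits_embed {E K L : Type*} [CommRing E] [IsDomain E] [Countable E] [Field K] [Countable K]
    [Field L] [IsAlgClosed L] [Uncountable L] (f : E →+* K) (hf : Function.Injective f)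
    (g : E →+* L) (hg : Function.Injective g) : ∃ σ : K →+* L, ∀ e, σ (f e) = g e := by
  letI : Algebra E K := f.toAlgebra
  letI : Algebra E L := g.toAlgebra
  haveI : FaithfulSMul E K := (faithfulSMul_iff_algebraMap_injective E K).2 hf
  haveI : FaithfulSMul E L := (faithfulSMul_iff_algebraMap_injective E L).2 hg
  obtain ⟨s, hs⟩ := exists_isTranscendenceBasis E K
  obtain ⟨t, ht⟩ := exists_isTranscendenceBasis E L
  have hinf : Infinite t := by
    by_contra hfin
    rw [not_infinite_iff_finite] at hfin
    have h1 := IsAlgClosed.cardinal_le_max_transcendence_basis (fun i : t => (i : L)) ht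
    have h2 : Cardinal.mk L ≤ Cardinal.aleph0 := by
      rw [← Cardinal.lift_le_aleph0]
      refine h1.trans (max_le (max_le ?_ ?_) ?_) <;> simp [Cardinal.mk_le_aleph0]
    exact not_countable (α := L) (Cardinal.mk_le_aleph0_iff.1 h2)
  obtain ⟨i1, hi1⟩ := exists_injective_nat s
  let i2 : ℕ ↪ t := Infinite.natEmbedding t
  have hx : AlgebraicIndependent E (fun i : s => ((i2 (i1 i) : t) : L)) :=
    ht.1.comp (fun i : s => i2 (i1 i)) (i2.injective.comp hi1)
  let A0 := Algebra.adjoin E (Set.range fun i : s => (i : K))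
  let φ : A0 →ₐ[E] L := (MvPolynomial.aeval (fun i : s => ((i2 (i1 i) : t) : L))).comp
    (hs.1.aevalEquiv.symm : A0 →ₐ[E] MvPolynomial s E)
  have hφ : Function.Injective φ := by
    change Function.Injective ((MvPolynomial.aeval (fun i : s => ((i2 (i1 i) : t) : L))) ∘
      hs.1.aevalEquiv.symm)
    exact Function.Injective.comp hx hs.1.aevalEquiv.symm.injective
  letI : Algebra A0 L := φ.toRingHom.toAlgebra
  haveI : FaithfulSMul A0 L := (faithfulSMul_iff_algebraMap_injective A0 L).2 hφ
  haveI : Algebra.IsAlgebraic A0 K := hs.isAlgebraic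
  let σ : K →ₐ[A0] L := IsAlgClosed.lift
  refine ⟨σ, fun e => ?_⟩
  have h1 : f e = algebraMap A0 K (algebraMap E A0 e) := rfl
  rw [h1]
  change σ _ = _
  rw [σ.commutes]
  exact φ.commutes e

/-- The conclusion of the local field theorem. -/
def TitsLocal (K : Type*) [Field K] (lam : K) : Prop :=
  ∃ (F : Type) (_ : NontriviallyNormedField F) (_ : ProperSpace F) (σ : K →+* F), ‖σ lam‖ ≠ 1

theorem tits_countable {K : Type*} [Field K] (T : Set K) (hT : T.Finite)
    (hT' : Subfield.closure T = ⊤) : Countable K := by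
  have h1 := Subfield.cardinalMk_closure_le_max T
  rw [hT'] at h1
  have h2 : Cardinal.mk T ≤ Cardinal.aleph0 := Cardinal.mk_le_aleph0_iff.2 hT.countable
  have h3 : Cardinal.mk (⊤ : Subfield K) ≤ Cardinal.aleph0 := h1.trans (by simp [h2])
  have h4 := Cardinal.mk_le_aleph0_iff.1 h3
  exact (Subfield.topEquiv (K := K)).symm.injective.countable

theorem tits_local_complex {E K : Type*} [CommRing E] [IsDomain E] [Countable E] [Field K]
    [Countable K] (f : E →+* K) (hf : Function.Injective f)
    (g : E →+* ℂ) (hg : Function.Injective g) (e : E) (he : ‖g e‖ ≠ 1) : TitsLocal K (f e) := by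
  haveI : Uncountable ℂ := by
    rw [← not_countable_iff, ← Set.countable_univ_iff]; exact not_countable_complex
  obtain ⟨σ, hσ⟩ := tits_embed f hf g hg
  exact ⟨ℂ, inferInstance, inferInstance, σ, by rwa [hσ]⟩

theorem tits_local_nonarch {F0 : Type} [NontriviallyNormedField F0] [IsUltrametricDist F0]
    [ProperSpace F0] {E K : Type*} [CommRing E] [IsDomain E] [Countable E] [Field K]
    (T : Set K) (hT : T.Finite) (hT' : Subfield.closure T = ⊤)
    (f : E →+* K) (hf : Function.Injective f)
    (g : E →+* AlgebraicClosure F0) (hg : Function.Injective g) (e : E)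
    (he : spectralNorm F0 (AlgebraicClosure F0) (g e) ≠ 1) : TitsLocal K (f e) := by
  haveI := tits_countable T hT hT'
  haveI : Uncountable F0 := by
    rw [← not_countable_iff, ← Cardinal.mk_le_aleph0_iff]
    have := continuum_le_cardinal_of_nontriviallyNormedField F0
    intro h
    exact absurd (this.trans h) (not_le.2 Cardinal.aleph0_lt_continuum)
  haveI : Uncountable (AlgebraicClosure F0) :=
    (algebraMap F0 (AlgebraicClosure F0)).injective.uncountable
  obtain ⟨σ, hσ⟩ := tits_embed f hf g hg
  let F : IntermediateField F0 (AlgebraicClosure F0) := IntermediateField.adjoin F0 (σ '' T)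
  haveI : FiniteDimensional F0 F := by
    haveI : Finite (σ '' T) := (hT.image σ).to_subtype
    exact IntermediateField.finiteDimensional_adjoin
      (fun x _ => Algebra.IsIntegral.isIntegral x)
  have hmem : ∀ x, σ x ∈ F := by
    intro x
    have hx : x ∈ Subfield.closure T := by rw [hT']; trivial
    have : Subfield.closure T ≤ F.toSubfield.comap σ := by
      rw [Subfield.closure_le]
      intro y hy
      exact IntermediateField.subset_adjoin F0 _ ⟨y, hy, rfl⟩
    exact this hx
  let σ' : K →+* F := RingHom.codRestrict σ F hmem
  letI : NontriviallyNormedField F := spectralNorm.nontriviallyNormedField F0 F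
  letI : NormedSpace F0 F := spectralNorm.normedSpace F0 F
  refine ⟨F, inferInstance, FiniteDimensional.proper F0 F, σ', ?_⟩
  change spectralNorm F0 F (σ' (f e)) ≠ 1
  rw [spectralNorm.eq_of_tower (L := AlgebraicClosure F0)]
  have : algebraMap F (AlgebraicClosure F0) (σ' (f e)) = g e := hσ e
  rw [this]
  exact he


theorem tits_poly_countable (R : Type*) [CommRing R] [Countable R] : Countable (Polynomial R) := by
  rw [← Cardinal.mk_le_aleph0_iff]
  refine Polynomial.cardinalMk_le_max.trans (max_le ?_ le_rfl)
  rw [Cardinal.mk_le_aleph0_iff]; infer_instance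

theorem tits_rat_int (q : ℚ) (h : ∀ (p : ℕ) [Fact p.Prime], ‖(q : ℚ_[p])‖ ≤ 1) :
    ∃ z : ℤ, (z : ℚ) = q := by
  by_cases hd : q.den = 1
  · exact ⟨q.num, Rat.coe_int_num_of_den_eq_one hd⟩
  · exfalso
    obtain ⟨p, hp, hpd⟩ := Nat.exists_prime_and_dvd hd
    haveI : Fact p.Prime := ⟨hp⟩
    have h1 : (q.num : ℚ_[p]) = q * (q.den : ℚ_[p]) := by
      have := Rat.mul_den_eq_num q
      exact_mod_cast congrArg (Rat.cast : ℚ → ℚ_[p]) this.symm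
    have h2 : ‖((q.den : ℤ) : ℚ_[p])‖ < 1 := by
      rw [Padic.norm_intCast_lt_one_iff]; exact_mod_cast hpd
    have h3 : ‖(q.num : ℚ_[p])‖ < 1 := by
      rw [h1, norm_mul]
      push_cast at h2
      calc _ ≤ 1 * ‖(q.den : ℚ_[p])‖ := mul_le_mul_of_nonneg_right (h p) (norm_nonneg _)
        _ < 1 := by rw [one_mul]; exact h2
    rw [Padic.norm_intCast_lt_one_iff] at h3
    have h4 : p ∣ q.num.natAbs := Int.natCast_dvd.1 h3
    have := Nat.dvd_gcd h4 hpd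
    rw [Nat.Coprime.gcd_eq_one q.reduced] at this
    exact hp.one_lt.ne' (Nat.dvd_one.1 this)

theorem tits_padic_coeff (p : ℕ) [Fact p.Prime] (P : Polynomial ℚ) (hP : P.Monic)
    (h : ∀ z ∈ P.rootSet (PadicAlgCl p), ‖z‖ ≤ 1) (i : ℕ) : ‖((P.coeff i : ℚ) : ℚ_[p])‖ ≤ 1 := by
  let O : Subring (PadicAlgCl p) := (Valued.v : Valuation (PadicAlgCl p) NNReal).integer
  have hO : ∀ z : PadicAlgCl p, z ∈ O ↔ ‖z‖ ≤ 1 := fun z => Iff.rfl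
  let P' := P.map (algebraMap ℚ (PadicAlgCl p))
  have hs : P'.Splits := IsAlgClosed.splits _
  have h1 := hs.eq_prod_roots_of_monic (hP.map _)
  have h2 : P' ∈ Polynomial.liftsRing O.subtype := by
    rw [h1]
    apply Subring.multiset_prod_mem
    intro Q hQ
    obtain ⟨r, hr, rfl⟩ := Multiset.mem_map.1 hQ
    have hrO : r ∈ O := by
      rw [hO]; apply h
      rw [Polynomial.mem_rootSet']
      refine ⟨(hP.map _).ne_zero, ?_⟩
      have := Polynomial.isRoot_of_mem_roots hr
      rw [Polynomial.IsRoot, Polynomial.eval_map] at this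
      exact this
    apply Subring.sub_mem
    · exact Polynomial.X_mem_lifts _
    · exact Polynomial.C'_mem_lifts (f := O.subtype) ⟨⟨r, hrO⟩, rfl⟩
  have h3 := (Polynomial.lifts_iff_coeff_lifts P').1 h2 i
  obtain ⟨y, hy⟩ := h3
  have h4 : P'.coeff i = algebraMap ℚ_[p] (PadicAlgCl p) ((P.coeff i : ℚ) : ℚ_[p]) := by
    simp [P', Polynomial.coeff_map]
  have h5 : P'.coeff i ∈ O := by rw [← hy]; exact y.2
  rw [hO, h4, PadicAlgCl.norm_extends] at h5
  exact h5

theorem tits_local_char0 {K : Type*} [Field K] [CharZero K] (T : Set K) (hT : T.Finite)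
    (hT' : Subfield.closure T = ⊤) (lam : K) (hroot : ∀ m : ℕ, 0 < m → lam ^ m ≠ 1) :
    TitsLocal K lam := by
  haveI := tits_countable T hT hT'
  by_cases halg : IsAlgebraic ℚ lam
  · let E := IntermediateField.adjoin ℚ {lam}
    let x : E := IntermediateField.AdjoinSimple.gen ℚ lam
    haveI : FiniteDimensional ℚ E := IntermediateField.adjoin.finiteDimensional halg.isIntegral
    haveI : NumberField E := { to_charZero := inferInstance, to_finiteDimensional := inferInstance }
    haveI : Countable E := Subtype.countable
    have hfx : algebraMap E K x = lam := rfl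
    rw [← hfx]
    by_cases hC : ∀ φ : E →+* ℂ, ‖φ x‖ = 1
    · have hxint : ¬ IsIntegral ℤ x := by
        intro hxint
        obtain ⟨m, hm, hxm⟩ := NumberField.Embeddings.pow_eq_one_of_norm_eq_one E ℂ hxint hC
        apply hroot m hm
        rw [← hfx, ← map_pow, hxm, map_one]
      by_contra hloc
      have hp : ∀ (p : ℕ) [Fact p.Prime], ∀ φ : E →ₐ[ℚ] PadicAlgCl p, ‖φ x‖ = 1 := by
        intro p _ φ
        by_contra hne
        exact hloc (tits_local_nonarch (F0 := ℚ_[p]) T hT hT' (algebraMap E K)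
          (algebraMap E K).injective (φ : E →+* PadicAlgCl p) (RingHom.injective _) x hne)
      apply hxint
      have hx : IsIntegral ℚ x := Algebra.IsIntegral.isIntegral x
      have hc : ∀ i, ∃ z : ℤ, (z : ℚ) = (minpoly ℚ x).coeff i := by
        intro i
        apply tits_rat_int
        intro p _
        apply tits_padic_coeff p _ (minpoly.monic hx)
        intro z hz
        rw [← Algebra.IsAlgebraic.range_eval_eq_rootSet_minpoly] at hz
        obtain ⟨φ, rfl⟩ := hz
        exact (hp p φ).le
      have hl : minpoly ℚ x ∈ Polynomial.lifts (algebraMap ℤ ℚ) := by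
        rw [Polynomial.lifts_iff_coeff_lifts]
        intro i
        obtain ⟨z, hz⟩ := hc i
        exact ⟨z, hz⟩
      obtain ⟨Q, hQ, -, hQm⟩ := Polynomial.lifts_and_degree_eq_and_monic hl (minpoly.monic hx)
      refine ⟨Q, hQm, ?_⟩
      have h1 := minpoly.aeval ℚ x
      rw [← hQ, Polynomial.aeval_map_algebraMap] at h1
      exact h1
    · push Not at hC
      obtain ⟨φ, hφ⟩ := hC
      exact tits_local_complex (algebraMap E K) (algebraMap E K).injective φ φ.injective x hφ
  · obtain ⟨z, hz, hz1⟩ : ∃ z : ℂ, Transcendental ℚ z ∧ ‖z‖ ≠ 1 := by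
      have h0 : ∃ z : ℂ, Transcendental ℚ z := by
        by_contra! hcon
        have h1 : Set.Countable {x : ℂ | IsAlgebraic ℚ x} := Algebraic.countable ℚ ℂ
        have h2 : {x : ℂ | IsAlgebraic ℚ x} = Set.univ := by
          ext x
          simpa [Transcendental] using hcon x
        rw [h2] at h1
        exact not_countable_complex h1
      obtain ⟨z, hz⟩ := h0
      by_cases h1 : ‖z‖ = 1
      · refine ⟨z + z, ?_, ?_⟩
        · intro h
          apply hz
          have h2 : z = (z + z) * algebraMap ℚ ℂ (1 / 2) := by simp; ring
          rw [h2]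
          exact h.mul (isAlgebraic_algebraMap _)
        · rw [← two_mul, norm_mul, h1]; norm_num
      · exact ⟨z, hz, h1⟩
    haveI : Countable (Polynomial ℚ) := tits_poly_countable ℚ
    have h1 := tits_local_complex (E := Polynomial ℚ) (K := K)
      (Polynomial.aeval lam : Polynomial ℚ →ₐ[ℚ] K).toRingHom
      (transcendental_iff_injective.1 halg)
      (Polynomial.aeval z : Polynomial ℚ →ₐ[ℚ] ℂ).toRingHom
      (transcendental_iff_injective.1 hz) Polynomial.X (by simpa using hz1)
    simpa using h1


open scoped LaurentSeries Valued in
theorem tits_laurent (p : ℕ) [Fact p.Prime] :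
    ∃ (F0 : Type) (_ : NontriviallyNormedField F0) (_ : IsUltrametricDist F0)
      (_ : ProperSpace F0) (g : Polynomial (ZMod p) →+* F0),
      Function.Injective g ∧ ‖g Polynomial.X‖ < 1 := by
  classical
  have hX : (Valued.v (HahnSeries.single (1 : ℤ) (1 : ZMod p) : LaurentSeries (ZMod p))) = WithZero.exp (-1 : ℤ) :=
    LaurentSeries.valuation_single_zpow (ZMod p) 1
  haveI hnt : (Valued.v : Valuation (LaurentSeries (ZMod p)) _).IsNontrivial := by
    refine ⟨⟨HahnSeries.single (1 : ℤ) (1 : ZMod p), ?_, ?_⟩⟩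
    · rw [hX]; exact WithZero.exp_ne_zero
    · rw [hX]; simp
  haveI : MulArchimedean (MonoidWithZeroHom.ValueGroup₀ (.ofClass (Valued.v : Valuation (LaurentSeries (ZMod p)) _))) := 
    MulArchimedean.comap MonoidWithZeroHom.ValueGroup₀.embedding.toMonoidHom MonoidWithZeroHom.ValueGroup₀.embedding_strictMono
  obtain ⟨hr⟩ := (Valuation.nonempty_rankOne_iff_mulArchimedean (v := (Valued.v : Valuation (LaurentSeries (ZMod p)) _))).2 this
  letI := hr
  let e0 : PowerSeries (ZMod p) →+* 𝒪[LaurentSeries (ZMod p)] :=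
    (algebraMap (PowerSeries (ZMod p)) (LaurentSeries (ZMod p))).codRestrict _ (fun f => by
      rw [Valuation.mem_integer_iff, LaurentSeries.val_le_one_iff_eq_coe]; exact ⟨f, rfl⟩)
  have he0 : Function.Bijective e0 := by
    constructor
    · intro a b h
      have := congrArg Subtype.val h
      exact HahnSeries.ofPowerSeries_injective this
    · rintro ⟨x, hx⟩
      rw [Valuation.mem_integer_iff, LaurentSeries.val_le_one_iff_eq_coe] at hx
      obtain ⟨F, rfl⟩ := hx
      exact ⟨F, rfl⟩
  let e := RingEquiv.ofBijective e0 he0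
  have hdvr : IsDiscreteValuationRing 𝒪[LaurentSeries (ZMod p)] := 
    IsDiscreteValuationRing.RingEquivClass.isDiscreteValuationRing e
  have hfin : Finite 𝓀[LaurentSeries (ZMod p)] := by
    refine Finite.of_equiv (ZMod p) (PowerSeries.residueFieldOfPowerSeries.symm.trans (IsLocalRing.ResidueField.mapEquiv e)).toEquiv
  have hprop : ProperSpace (LaurentSeries (ZMod p)) := 
    Valued.integer.properSpace_iff_completeSpace_and_isDiscreteValuationRing_integer_and_finite_residueField.2
      ⟨inferInstance, hdvr, hfin⟩
  refine ⟨LaurentSeries (ZMod p), inferInstance, inferInstance, hprop, 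
    (HahnSeries.ofPowerSeries ℤ (ZMod p)).comp (Polynomial.coeToPowerSeries.ringHom), ?_, ?_⟩
  · exact HahnSeries.ofPowerSeries_injective.comp (fun a b h => Polynomial.coe_injective _ h)
  · have : ((HahnSeries.ofPowerSeries ℤ (ZMod p)).comp (Polynomial.coeToPowerSeries.ringHom)) Polynomial.X
      = HahnSeries.single (1 : ℤ) (1 : ZMod p) := by simp
    rw [this]
    rw [Valued.toNormedField.norm_lt_one_iff, hX, ← WithZero.exp_zero, WithZero.exp_lt_exp]
    norm_num

theorem tits_local_charp {K : Type*} [Field K] (p : ℕ) [Fact p.Prime] [CharP K p]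
    (T : Set K) (hT : T.Finite) (hT' : Subfield.closure T = ⊤) (lam : K) (h0 : lam ≠ 0)
    (hroot : ∀ m : ℕ, 0 < m → lam ^ m ≠ 1) : TitsLocal K lam := by
  letI := ZMod.algebra K p
  have htr : Transcendental (ZMod p) lam := by
    intro halg
    have hi : IsIntegral (ZMod p) lam := halg.isIntegral
    haveI : FiniteDimensional (ZMod p) (IntermediateField.adjoin (ZMod p) {lam}) :=
      IntermediateField.adjoin.finiteDimensional hi
    haveI : Finite (IntermediateField.adjoin (ZMod p) {lam}) := Module.finite_of_finite (ZMod p)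
    haveI := Fintype.ofFinite (IntermediateField.adjoin (ZMod p) {lam})
    let x : IntermediateField.adjoin (ZMod p) {lam} := ⟨lam, IntermediateField.mem_adjoin_simple_self _ _⟩
    have hx : x ≠ 0 := fun h => h0 (congrArg Subtype.val h)
    have := FiniteField.pow_card_sub_one_eq_one x hx
    refine hroot _ ?_ (congrArg Subtype.val this)
    have := Fintype.one_lt_card (α := IntermediateField.adjoin (ZMod p) {lam})
    omega
  obtain ⟨F0, i1, i2, i3, g, hg, hgX⟩ := tits_laurent p
  haveI : Countable (Polynomial (ZMod p)) := tits_poly_countable _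
  have := tits_local_nonarch (F0 := F0) T hT hT'
    (Polynomial.aeval (R := ZMod p) lam).toRingHom (transcendental_iff_injective.1 htr)
    ((algebraMap F0 (AlgebraicClosure F0)).comp g)
    ((algebraMap F0 (AlgebraicClosure F0)).injective.comp hg)
    Polynomial.X (by
      rw [RingHom.comp_apply, spectralNorm_extends]; exact hgX.ne)
  simpa using this

theorem tits_local {K : Type*} [Field K]
    (T : Set K) (hT : T.Finite) (hT' : Subfield.closure T = ⊤) (lam : K) (h0 : lam ≠ 0)
    (hroot : ∀ m : ℕ, 0 < m → lam ^ m ≠ 1) : TitsLocal K lam := by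
  obtain ⟨p, hp⟩ := CharP.exists K
  rcases CharP.char_is_prime_or_zero K p with h | h
  · haveI : Fact p.Prime := ⟨h⟩
    exact tits_local_charp p T hT hT' lam h0 hroot
  · subst h
    haveI := CharP.charP_to_charZero K
    exact tits_local_char0 T hT hT' lam hroot


def titsDiag (α : Type*) (k : ℕ) : Equiv.Perm α →* Equiv.Perm (α × Fin k) :=
  MonoidHom.mk' (fun s => Equiv.prodCongr s (Equiv.refl _)) (fun a b => by ext x <;> rfl)

theorem tits_root {α : Type*} (k : ℕ) (hk : 0 < k) (x : Equiv.Perm α) :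
    ∃ A : Equiv.Perm (α × Fin k), A ^ k = titsDiag α k x := by
  classical
  let f : α × Fin k → α × Fin k := fun q =>
    if h : q.2.1 + 1 < k then (q.1, ⟨q.2.1 + 1, h⟩) else (x q.1, ⟨0, hk⟩)
  have h1 : ∀ (m : ℕ) (i : α) (j : ℕ) (h : j + m < k),
      f^[m] (i, ⟨j, by omega⟩) = (i, ⟨j + m, h⟩) := by
    intro m
    induction m with
    | zero => intro i j h; rfl
    | succ m ih =>
      intro i j h
      rw [Function.iterate_succ_apply', ih i j (by omega)]
      simp only [f]
      rw [dif_pos (by omega)]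
      rfl
  have h2 : ∀ q, f^[k] q = titsDiag α k x q := by
    rintro ⟨i, j, hj⟩
    have hkk : k = j + (1 + (k - 1 - j)) := by omega
    have : f^[j + (1 + (k - 1 - j))] (i, ⟨j, hj⟩) = (x i, ⟨j, hj⟩) := by
      rw [Function.iterate_add_apply, Function.iterate_add_apply, h1 _ i j (by omega),
        Function.iterate_one]
      have : f (i, ⟨j + (k - 1 - j), by omega⟩) = (x i, ⟨0, hk⟩) := by
        simp only [f]
        rw [dif_neg (by omega)]
      rw [this, h1 j (x i) 0 (by omega)]
      simp
    rw [← hkk] at this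
    exact this
  have h3 : f^[k] = titsDiag α k x := funext h2
  obtain ⟨k', rfl⟩ : ∃ k', k = k' + 1 := ⟨k - 1, by omega⟩
  have hb : Function.Bijective f := by
    have hbij : Function.Bijective f^[k' + 1] := by rw [h3]; exact Equiv.bijective _
    constructor
    · have := hbij.1
      rw [Function.iterate_succ] at this
      exact Function.Injective.of_comp this
    · have := hbij.2
      rw [Function.iterate_succ'] at this
      exact Function.Surjective.of_comp this
  refine ⟨Equiv.ofBijective f hb, ?_⟩
  ext1 q
  rw [← h2 q, Equiv.Perm.coe_pow]
  rfl

theorem tits_free_not_solvable (M : Subgroup (FreeGroup (Fin 2))) [M.FiniteIndex]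
    (hs : Group.IsSolvable M) : False := by
  let k := M.normalCore.index
  have hk : 0 < k := Nat.pos_of_ne_zero Subgroup.FiniteIndex.index_ne_zero
  have hpow : ∀ g, g ^ k ∈ M := fun g =>
    M.normalCore_le (M.normalCore.pow_index_mem g)
  let s : Equiv.Perm (Fin 5) := finRotate 5
  obtain ⟨A, hA⟩ := tits_root k hk s
  obtain ⟨B, hB⟩ := tits_root k hk (Equiv.swap 0 (s 0))
  let ψ : FreeGroup (Fin 2) →* Equiv.Perm (Fin 5 × Fin k) := FreeGroup.lift ![A, B]
  have hψA : ψ (FreeGroup.of 0) = A := by simp [ψ]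
  have hψB : ψ (FreeGroup.of 1) = B := by simp [ψ]
  have hcl : Subgroup.closure ({s, Equiv.swap 0 (s 0)} : Set (Equiv.Perm (Fin 5))) = ⊤ :=
    Equiv.Perm.closure_cycle_adjacent_swap isCycle_finRotate support_finRotate 0
  have hle : (⊤ : Subgroup (Equiv.Perm (Fin 5))) ≤ (M.map ψ).comap (titsDiag (Fin 5) k) := by
    rw [← hcl, Subgroup.closure_le]
    rintro x (rfl | hx)
    · exact ⟨FreeGroup.of 0 ^ k, hpow _, by rw [map_pow, hψA, hA]⟩
    · rw [Set.mem_singleton_iff] at hx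
      subst hx
      exact ⟨FreeGroup.of 1 ^ k, hpow _, by rw [map_pow, hψB, hB]⟩
  have h1 : Group.IsSolvable (M.map ψ) :=
    Group.isSolvable_of_surjective (ψ.subgroupMap_surjective M)
  have hinj : Function.Injective ((titsDiag (Fin 5) k).codRestrict (M.map ψ) fun g => hle trivial) := by
    intro a b h
    have h' : titsDiag (Fin 5) k a = titsDiag (Fin 5) k b := congrArg Subtype.val h
    ext1 i
    have := congrArg (fun e => (e (i, ⟨0, hk⟩)).1) h'
    exact this
  exact Equiv.Perm.not_isSolvable_fin_5 (Group.isSolvable_of_isSolvable_injective hinj)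

theorem tits_exclusive {G : Type*} [Group G] (H : Subgroup G) (e : H ≃* FreeGroup (Fin 2))
    (N : Subgroup G) (hN : N.FiniteIndex) (hs : Group.IsSolvable N) : False := by
  let φ : FreeGroup (Fin 2) →* G := H.subtype.comp e.symm.toMonoidHom
  have hφ : Function.Injective φ := H.subtype_injective.comp e.symm.injective
  haveI : (N.comap φ).FiniteIndex := by
    refine ⟨?_⟩
    rw [Subgroup.index_comap]
    exact (inferInstance : (N.subgroupOf φ.range).FiniteIndex).index_ne_zero
  refine tits_free_not_solvable (N.comap φ) ?_
  have : Function.Injective (φ.subgroupComap N) := by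
    intro a b h
    have h' : φ a = φ b := by
      have h2 := congrArg (fun q : N => (q : G)) h
      exact h2
    exact Subtype.ext (hφ h')
  exact Group.isSolvable_of_isSolvable_injective this


theorem tits_closure_top {K : Type*} [Field K] (T : Set K) :
    Subfield.closure ((Subtype.val : Subfield.closure T → K) ⁻¹' T) = ⊤ := by
  set S := Subfield.closure ((Subtype.val : Subfield.closure T → K) ⁻¹' T)
  have h : Subfield.closure T ≤ S.map (Subfield.closure T).subtype := by
    rw [Subfield.closure_le]
    intro t ht
    exact ⟨⟨t, Subfield.subset_closure ht⟩, Subfield.subset_closure ht, rfl⟩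
  rw [eq_top_iff]
  rintro x -
  obtain ⟨y, hy, hyx⟩ := h x.2
  have : y = x := Subtype.ext hyx
  exact this ▸ hy

theorem tits_core {K G : Type*} [Field K] [Group G] {n : ℕ} (ρ : G →* Matrix (Fin n) (Fin n) K)
    (hdom : ∀ f ∈ titsAlg ρ, ∀ g ∈ titsAlg ρ, f * g = 0 → f = 0 ∨ g = 0)
    (T : Set K) (hT : T.Finite) (hent : ∀ g i j, ρ g i j ∈ Subfield.closure T)
    (d : G) (hd : d ∈ commutator G) (z : K) (v : Fin n → K) (hv : v ≠ 0)
    (hz : (ρ d).mulVec v = z • v) (hroot : ∀ m : ℕ, 0 < m → z ^ m ≠ 1) :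
    ∃ a : Fin 2 → G, Function.Injective (FreeGroup.lift a) := by
  classical
  have hz0 : z ≠ 0 := by
    rintro rfl
    apply hv
    have : (ρ (d⁻¹ * d)).mulVec v = 0 := by
      rw [map_mul, ← Matrix.mulVec_mulVec, hz, zero_smul, Matrix.mulVec_zero]
    simpa using this
  let T' := insert z T
  have hTT : Subfield.closure T ≤ Subfield.closure T' := Subfield.closure_mono (Set.subset_insert _ _)
  let K0 := Subfield.closure T'
  let z0 : K0 := ⟨z, Subfield.subset_closure (Set.mem_insert _ _)⟩
  have hz00 : z0 ≠ 0 := fun h => hz0 (congrArg Subtype.val h)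
  obtain ⟨F, i1, i2, σ, hσ⟩ := tits_local (K := K0) (Subtype.val ⁻¹' T')
    ((hT.insert z).preimage Subtype.val_injective.injOn) (tits_closure_top T') z0
    hz00 (fun m hm h => hroot m hm (congrArg Subtype.val h))
  let ρ0 := titsLift ρ K0 (fun g i j => hTT (hent g i j))
  letI : Algebra K0 F := σ.toAlgebra
  let ρF : G →* Matrix (Fin n) (Fin n) F :=
    (σ.mapMatrix : Matrix (Fin n) (Fin n) K0 →+* Matrix (Fin n) (Fin n) F).toMonoidHom.comp ρ0
  have hdomF := titsAlg_transfer ρ0 ρ ρF (fun g i j => rfl) (fun g i j => rfl) hdom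
  -- eigenvalue
  have heig : ∀ (d : G) (z : K) (z0 : K0) (_ : (z0 : K) = z) (_ : (ρ d).mulVec v = z • v),
      ∃ w : Fin n → F, w ≠ 0 ∧ (ρF d).mulVec w = σ z0 • w := by
    intro d z z0 h1 h2
    have hdet : (ρ d - Matrix.scalar (Fin n) z).det = 0 := by
      rw [← Matrix.exists_mulVec_eq_zero_iff]
      refine ⟨v, hv, ?_⟩
      rw [Matrix.sub_mulVec, h2]
      ext i
      simp [Matrix.mulVec, dotProduct, Matrix.diagonal_apply]
    have hmap : ρ d - Matrix.scalar (Fin n) z = (algebraMap K0 K).mapMatrix (ρ0 d - Matrix.scalar (Fin n) z0) := by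
      ext i j
      subst h1
      simp only [RingHom.mapMatrix_apply, Matrix.map_apply, Matrix.sub_apply, Matrix.scalar_apply,
        Matrix.diagonal_apply, map_sub]
      congr 1
      split_ifs
      · rfl
      · simp
    rw [hmap, ← RingHom.map_det, map_eq_zero] at hdet
    have hdetF : (σ.mapMatrix (ρ0 d - Matrix.scalar (Fin n) z0)).det = 0 := by
      rw [← RingHom.map_det, hdet, map_zero]
    rw [← Matrix.exists_mulVec_eq_zero_iff] at hdetF
    obtain ⟨w, hw, hw'⟩ := hdetF
    refine ⟨w, hw, ?_⟩
    have : σ.mapMatrix (ρ0 d - Matrix.scalar (Fin n) z0) = ρF d - Matrix.scalar (Fin n) (σ z0) := by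
      ext i j
      simp only [RingHom.mapMatrix_apply, Matrix.map_apply, Matrix.sub_apply, Matrix.scalar_apply,
        Matrix.diagonal_apply, map_sub]
      congr 1
      split_ifs
      · rfl
      · simp
    rw [this, Matrix.sub_mulVec, sub_eq_zero] at hw'
    rw [hw']
    ext i
    simp [Matrix.mulVec, dotProduct, Matrix.diagonal_apply]
  have hfin : ∀ (d : G) (_ : d ∈ commutator G) (lam : F) (_ : 1 < ‖lam‖) (w : Fin n → F)
      (_ : w ≠ 0) (_ : (ρF d).mulVec w = lam • w),
      ∃ a : Fin 2 → G, Function.Injective (FreeGroup.lift a) := by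
    intro d hd lam hlam w hw hdw
    refine tits_rep (titsAlg ρF) hdomF (titsAlg_inv ρF) d hd lam hlam n (Fin n → F) (by simp)
      ((Matrix.toLinAlgEquiv' : Matrix (Fin n) (Fin n) F ≃ₐ[F] _).toAlgHom.toRingHom.toMonoidHom.comp ρF)
      ?_ w hw ?_
    · intro φ u
      have : (fun h => φ ((ρF h).mulVec u)) = fun h => ∑ i, (∑ j, ρF h i j * u j) * φ (Pi.single i 1) := by
        ext h
        conv_lhs => rw [← Finset.univ_sum_single ((ρF h).mulVec u), map_sum]
        refine Finset.sum_congr rfl fun i _ => ?_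
        have hs : (Pi.single i ((ρF h).mulVec u i) : Fin n → F) =
            ((ρF h).mulVec u i) • (Pi.single i 1 : Fin n → F) := by
          rw [← Pi.single_smul, smul_eq_mul, mul_one]
        rw [hs, map_smul, smul_eq_mul]
        rfl
      show (fun h => φ ((ρF h).mulVec u)) ∈ _
      rw [this]
      exact titsAlg_sum ρF _ _ (fun i => titsAlg_sum ρF _ _ (fun j => titsAlg_mem ρF i j) (fun j => titsAlg_const ρF _))
        (fun j => titsAlg_const ρF _)
    · exact hdw
  rcases lt_or_gt_of_ne hσ with h | h
  · obtain ⟨w, hw, hw'⟩ := heig d⁻¹ z⁻¹ z0⁻¹ rfl (by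
      have h3 : (ρ (d⁻¹ * d)).mulVec v = z • (ρ d⁻¹).mulVec v := by
        rw [map_mul, ← Matrix.mulVec_mulVec, hz, Matrix.mulVec_smul]
      rw [inv_mul_cancel, map_one, Matrix.one_mulVec] at h3
      conv_rhs => rw [h3]
      rw [smul_smul, inv_mul_cancel₀ hz0, one_smul])
    refine hfin d⁻¹ (inv_mem hd) _ ?_ w hw hw'
    rw [map_inv₀, norm_inv]
    refine (one_lt_inv₀ ?_).2 h
    simpa using hz00
  · obtain ⟨w, hw, hw'⟩ := heig d z z0 rfl hz
    exact hfin d hd _ h w hw hw'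

theorem tits_main {K G : Type*} [Field K] [IsAlgClosed K] [Group G] [Group.FG G] {n : ℕ}
    (ρ : G →* Matrix (Fin n) (Fin n) K) (hρ : Function.Injective ρ)
    (hns : ¬ ∃ H : Subgroup G, H.FiniteIndex ∧ Group.IsSolvable H) :
    ∃ a : Fin 2 → G, Function.Injective (FreeGroup.lift a) := by
  obtain ⟨T, hT, hent⟩ := tits_entries ρ
  obtain ⟨Δ1, hΔ1, hcong⟩ := tits_congruence ρ
  obtain ⟨Δ2, hΔ2, hdom⟩ := tits_connected_rep (ρ.comp Δ1.subtype)
  let ι : Δ2 →* G := Δ1.subtype.comp Δ2.subtype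
  have hι : Function.Injective ι := Δ1.subtype_injective.comp Δ2.subtype_injective
  have hfi : (Δ2.map Δ1.subtype).FiniteIndex := by
    refine ⟨?_⟩
    rw [Subgroup.index_map_subtype]
    exact mul_ne_zero hΔ2.index_ne_zero hΔ1.index_ne_zero
  have hnsol : ¬ Group.IsSolvable Δ2 := by
    intro h
    refine hns ⟨_, hfi, ?_⟩
    exact Group.isSolvable_of_surjective (Δ1.subtype.subgroupMap_surjective Δ2)
  have h1 : ¬ ∀ d ∈ commutator Δ2, ∀ (z : K) (v : Fin n → K), v ≠ 0 →
      ((ρ.comp ι) d).mulVec v = z • v → z = 1 := fun h =>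
    hnsol (tits_solvable (ρ.comp ι) (hρ.comp hι) h)
  push Not at h1
  obtain ⟨d, hd, z, v, hv, hz, hz1⟩ := h1
  obtain ⟨a, ha⟩ := tits_core (ρ.comp ι) hdom T hT (fun g i j => by
      have := hent (ι g) i j
      have hle : Algebra.adjoin ℤ T ≤ subalgebraOfSubring (Subfield.closure T).toSubring := 
        Algebra.adjoin_le Subfield.subset_closure
      exact hle this) d hd z v hv hz
    (fun m hm h => hz1 (hcong (ι d) (d : Δ1).2 z v hv hz m hm h))
  refine ⟨ι ∘ a, ?_⟩
  have : FreeGroup.lift (ι ∘ a) = ι.comp (FreeGroup.lift a) := by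
    ext i; simp
  rw [this]
  exact hι.comp ha

theorem tits_alternative {k : Type*} [Field k] (n : ℕ) (hn : 1 ≤ n)
    (Γ : Subgroup (Matrix.GeneralLinearGroup (Fin n) k)) [Group.FG Γ] :
    Xor' (∃ H : Subgroup Γ, Nonempty (H ≃* FreeGroup (Fin 2)))
      (∃ H : Subgroup Γ, H.FiniteIndex ∧ IsSolvable H) := by
  have hex : (∃ H : Subgroup Γ, Nonempty (H ≃* FreeGroup (Fin 2))) →
      ¬ (∃ H : Subgroup Γ, H.FiniteIndex ∧ IsSolvable H) := by
    rintro ⟨H, ⟨e⟩⟩ ⟨N, hN, hs⟩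
    exact tits_exclusive H e N hN hs
  by_cases h : ∃ H : Subgroup Γ, H.FiniteIndex ∧ IsSolvable H
  · exact Or.inr ⟨h, fun h' => hex h' h⟩
  · refine Or.inl ⟨?_, h⟩
    let K := AlgebraicClosure k
    let ρ : Γ →* Matrix (Fin n) (Fin n) K :=
      ((algebraMap k K).mapMatrix : Matrix (Fin n) (Fin n) k →+* Matrix (Fin n) (Fin n) K).toMonoidHom.comp
        ((Units.coeHom (Matrix (Fin n) (Fin n) k)).comp Γ.subtype)
    have hρ : Function.Injective ρ := by
      intro a b hab
      apply Subtype.ext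
      apply Units.ext
      ext i j
      exact (algebraMap k K).injective (congrFun (congrFun hab i) j)
    obtain ⟨a, ha⟩ := tits_main ρ hρ h
    exact ⟨_, ⟨(MonoidHom.ofInjective ha).symm⟩⟩
end
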